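/- arXiv:1512.00962 — 6 statements merged into one kernel-verified Lean document; each statement's English description precedes it below -/
import Mathlib

section
/- Let q be an odd prime power and let z be a nonzero element of F_{q^3} with Tr_{q^3/q}(z^2) ≠ 0. Call a two-dimensional F_q-subspace W of F_{q^3} a tangent line of the conic if W contains exactly one one-dimensional F_q-subspace spanned by an element y with Tr_{q^3/q}(y^2) = 0. Then the point spanned by z lies on exactly two tangent lines if sgn(Tr_{q^3/q}(z^2)) = ε, and lies on no tangent line if sgn(Tr_{q^3/q}(z^2)) = -ε, where ε = 1 if q ≡ 1 (mod 4) and ε = -1 if q ≡ 3 (mod 4). (That is, a point off the conic is an exterior point if and only if sgn(f(z)) = ε, and an interior point if and only if sgn(f(z)) = -ε.) -/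
open scoped Classical

/-- In a finite field, a product of two nonzero elements is a square if and only if both or neither
of the factors are squares. -/
theorem FiniteField.isSquare_mul_iff {F : Type*} [Field F] [Finite F] {a b : F} (ha : a ≠ 0)
    (hb : b ≠ 0) : IsSquare (a * b) ↔ (IsSquare a ↔ IsSquare b) := by
  have := Fintype.ofFinite F
  rw [← quadraticChar_one_iff_isSquare (mul_ne_zero ha hb), ← quadraticChar_one_iff_isSquare ha,
    ← quadraticChar_one_iff_isSquare hb, map_mul]
  rcases quadraticChar_dichotomy ha with h | h <;> rcases quadraticChar_dichotomy hb with h' | h' <;>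
    simp [h, h']

/-- An element of the base field that becomes a square in an extension of odd degree is already
a square. -/
theorem isSquare_of_isSquare_algebraMap {K L : Type*} [Field K] [Field L] [Algebra K L]
    (hodd : Odd (Module.finrank K L)) {a : K} (ha : IsSquare (algebraMap K L a)) :
    IsSquare a := by
  obtain ⟨d, hd⟩ := ha
  obtain ⟨m, hm⟩ := hodd
  have h := congrArg (Algebra.norm K) hd
  rw [Algebra.norm_algebraMap, map_mul, hm] at h
  rcases eq_or_ne a 0 with rfl | h0
  · exact IsSquare.zero
  · refine ⟨Algebra.norm K d / a ^ m, ?_⟩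
    field_simp
    linear_combination h

/-- In an odd degree extension of finite fields, Gram determinants of the trace form with respect
to as many vectors as the degree are squares. -/
theorem isSquare_det_trace_mul {K L : Type*} [Field K] [Field L] [Finite L] [Algebra K L]
    {n : ℕ} (hn : Module.finrank K L = n) (hodd : Odd n) (b : Fin n → L) :
    IsSquare (Matrix.of fun i j => Algebra.trace K L (b i * b j)).det := by
  apply isSquare_of_isSquare_algebraMap (L := L) (hn ▸ hodd)
  let M : Matrix (Fin n) (Fin n) L := Matrix.of fun i k => b i ^ Nat.card K ^ (k : ℕ)
  have hM : M.det * M.det = (M * M.transpose).det := by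
    rw [Matrix.det_mul, Matrix.det_transpose]
  refine ⟨M.det, ?_⟩
  rw [RingHom.map_det, hM]
  congr 1
  ext i j
  simp only [RingHom.mapMatrix_apply, Matrix.map_apply, Matrix.of_apply, Matrix.mul_apply,
    Matrix.transpose_apply, M, FiniteField.algebraMap_trace_eq_sum_pow, hn, Finset.sum_range,
    mul_pow]

section BilinForm

variable {K V : Type*} [Field K] [AddCommGroup V] [Module K V] {B : LinearMap.BilinForm K V}

/-- A plane spanned by a nonisotropic vector and a nonzero vector orthogonal to it has exactly one
isotropic point if and only if the second vector is isotropic. -/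
theorem ncard_isotropic_eq_one_iff (h2 : (2 : K) ≠ 0) (hB : B.IsSymm) {z w : V}
    (hz : B z z ≠ 0) (hw : w ≠ 0) (hzw : B z w = 0) :
    {P : Submodule K V | Module.finrank K P = 1 ∧ P ≤ Submodule.span K {z, w} ∧
      ∃ y : V, P = Submodule.span K {y} ∧ B y y = 0}.ncard = 1 ↔ B w w = 0 := by
  have hwz : B w z = 0 := hB.eq z w ▸ hzw
  have hval (a b : K) : B (a • z + b • w) (a • z + b • w) = a ^ 2 * B z z + b ^ 2 * B w w := by
    simp [hzw, hwz]
    ring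
  constructor
  · intro h
    obtain ⟨P, hP⟩ := Set.ncard_eq_one.mp h
    obtain ⟨h1, hle, y, rfl, hy⟩ := hP.symm ▸ Set.mem_singleton P
    obtain ⟨a, b, rfl⟩ := Submodule.mem_span_pair.mp (hle (Submodule.mem_span_singleton_self y))
    have hy0 : a • z + b • w ≠ 0 := by
      intro h0
      rw [h0, Submodule.span_zero_singleton, finrank_bot] at h1
      exact zero_ne_one h1
    by_contra hww
    rw [hval] at hy
    have ha : a ≠ 0 := by
      rintro rfl
      simp_all
    have hb : b ≠ 0 := by
      rintro rfl
      simp_all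
    have hne : a • z + (-b) • w ≠ 0 := by
      intro h0
      simpa [hzw, ha, hz] using congrArg (B z) h0
    have hmem : Submodule.span K {a • z + (-b) • w} ∈ ({Submodule.span K {a • z + b • w}} :
        Set (Submodule K V)) := by
      rw [← hP]
      refine ⟨finrank_span_singleton hne, ?_, _, rfl, by rw [hval, neg_sq, hy]⟩
      rw [Submodule.span_singleton_le_iff_mem]
      exact Submodule.mem_span_pair.mpr ⟨a, -b, rfl⟩
    have hmem' := Submodule.mem_span_singleton_self (R := K) (a • z + (-b) • w)
    rw [Set.mem_singleton_iff.mp hmem] at hmem'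
    obtain ⟨k, hk⟩ := Submodule.mem_span_singleton.mp hmem'
    have hk1 : k = 1 := by simpa [hzw, ha, hz] using congrArg (B z) hk
    have hk2 := congrArg (B w) hk
    simp only [hk1, one_smul, map_add, map_smul, hwz, smul_eq_mul, mul_zero, zero_add] at hk2
    have : 2 * b * B w w = 0 := by linear_combination hk2
    simp_all
  · intro hww
    refine Set.ncard_eq_one.mpr ⟨Submodule.span K {w}, Set.eq_singleton_iff_unique_mem.mpr
      ⟨⟨finrank_span_singleton hw, Submodule.span_mono (by simp), w, rfl, hww⟩, ?_⟩⟩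
    rintro _ ⟨h1, hle, y, rfl, hy⟩
    obtain ⟨a, b, rfl⟩ := Submodule.mem_span_pair.mp (hle (Submodule.mem_span_singleton_self y))
    obtain rfl : a = 0 := by
      rw [hval] at hy
      simpa [hww, hz] using hy
    have hb : b ≠ 0 := by
      rintro rfl
      rw [zero_smul, zero_smul, zero_add, Submodule.span_zero_singleton, finrank_bot] at h1
      exact zero_ne_one h1
    rw [zero_smul, zero_add, Submodule.span_singleton_smul_eq hb.isUnit]

/-- The span of a nonisotropic vector and a nonzero vector orthogonal to it is a plane. -/
theorem finrank_span_pair_of_orthogonal {z w : V} (hz : B z z ≠ 0) (hw : w ≠ 0)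
    (hzw : B z w = 0) : Module.finrank K (Submodule.span K {z, w}) = 2 := by
  have hli : LinearIndependent K ![z, w] := by
    refine LinearIndependent.pair_iff.mpr fun a b hab => ?_
    obtain rfl : a = 0 := by simpa [hzw, hz] using congrArg (B z) hab
    simpa [hw] using hab
  have h := finrank_span_eq_card hli
  rwa [Matrix.range_cons_cons_empty, Fintype.card_fin] at h

/-- A plane through a nonisotropic vector is spanned by it and a vector orthogonal to it. -/
theorem exists_orthogonal_eq_span_pair {z : V} (hz : B z z ≠ 0) {W : Submodule K V}
    (hW : Module.finrank K W = 2) (hzW : z ∈ W) :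
    ∃ w : V, w ≠ 0 ∧ B z w = 0 ∧ W = Submodule.span K {z, w} := by
  have : FiniteDimensional K W := .of_finrank_eq_succ hW
  obtain ⟨x, hxW, hx⟩ : ∃ x ∈ W, x ∉ Submodule.span K {z} := by
    by_contra! h
    have h1 := Submodule.finrank_mono (show W ≤ Submodule.span K {z} from h)
    have h2 := finrank_span_le_card (R := K) ({z} : Set V)
    simp at h2
    omega
  have hw : x - (B z x / B z z) • z ≠ 0 := fun h =>
    hx (Submodule.mem_span_singleton.mpr ⟨_, (sub_eq_zero.mp h).symm⟩)
  have hzw : B z (x - (B z x / B z z) • z) = 0 := by simp [hz]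
  refine ⟨_, hw, hzw, (Submodule.eq_of_le_of_finrank_eq ?_ ?_).symm⟩
  · rw [Submodule.span_le, Set.insert_subset_iff, Set.singleton_subset_iff]
    exact ⟨hzW, W.sub_mem hxW (W.smul_mem _ hzW)⟩
  · rw [hW, finrank_span_pair_of_orthogonal hz hw hzw]

/-- The tangent lines of a conic through a point `z` off the conic join `z` to the isotropic points
of the polar line of `z`. -/
theorem setOf_tangent_eq_image (h2 : (2 : K) ≠ 0) (hB : B.IsSymm) {z : V} (hz : B z z ≠ 0) :
    {W : Submodule K V | Module.finrank K W = 2 ∧ Submodule.span K {z} ≤ W ∧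
      {P : Submodule K V | Module.finrank K P = 1 ∧ P ≤ W ∧ ∃ y : V,
        P = Submodule.span K {y} ∧ B y y = 0}.ncard = 1} =
      (fun w => Submodule.span K {z, w}) '' {w | w ≠ 0 ∧ B z w = 0 ∧ B w w = 0} := by
  ext W
  constructor
  · rintro ⟨hW, hzW, h⟩
    obtain ⟨w, hw, hzw, rfl⟩ := exists_orthogonal_eq_span_pair hz hW
      (hzW (Submodule.mem_span_singleton_self z))
    exact ⟨w, ⟨hw, hzw, (ncard_isotropic_eq_one_iff h2 hB hz hw hzw).mp h⟩, rfl⟩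
  · rintro ⟨w, ⟨hw, hzw, hww⟩, rfl⟩
    exact ⟨finrank_span_pair_of_orthogonal hz hw hzw, Submodule.span_mono (by simp),
      (ncard_isotropic_eq_one_iff h2 hB hz hw hzw).mpr hww⟩

/-- If the polar line of a point `z` off a conic has orthogonal basis `u, v`, the number of tangent
lines through `z` is determined by the quadratic character of `-(B u u * B v v)`. -/
theorem ncard_tangent_eq_ite (h2 : (2 : K) ≠ 0) (hB : B.IsSymm) {z u v : V} (hz : B z z ≠ 0)
    (hu : B u u ≠ 0) (hv : B v v ≠ 0) (hzu : B z u = 0) (hzv : B z v = 0) (huv : B u v = 0)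
    (hspan : ∀ w, B z w = 0 → w ∈ Submodule.span K {u, v}) :
    {W : Submodule K V | Module.finrank K W = 2 ∧ Submodule.span K {z} ≤ W ∧
      {P : Submodule K V | Module.finrank K P = 1 ∧ P ≤ W ∧ ∃ y : V,
        P = Submodule.span K {y} ∧ B y y = 0}.ncard = 1}.ncard =
      if IsSquare (-(B u u * B v v)) then 2 else 0 := by
  have hvu : B v u = 0 := hB.eq u v ▸ huv
  have hval (a b : K) : B (a • u + b • v) (a • u + b • v) = a ^ 2 * B u u + b ^ 2 * B v v := by
    simp [huv, hvu]
    ring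
  rw [setOf_tangent_eq_image h2 hB hz]
  split_ifs with hsq
  · obtain ⟨s, hs⟩ := hsq
    have hs0 : s ≠ 0 := by
      rintro rfl
      simp_all
    have hne (t : K) : t • u + B u u • v ≠ 0 := by
      intro h
      simpa [hvu, hu, hv] using congrArg (B v) h
    refine Set.ncard_eq_two.mpr ⟨Submodule.span K {z, s • u + B u u • v},
      Submodule.span K {z, (-s) • u + B u u • v}, ?_, ?_⟩
    · intro h
      have hmem : s • u + B u u • v ∈ Submodule.span K {z, s • u + B u u • v} :=
        Submodule.subset_span (by simp)
      rw [h] at hmem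
      obtain ⟨a, b, hab⟩ := Submodule.mem_span_pair.mp hmem
      obtain rfl : a = 0 := by simpa [hzu, hzv, hz] using congrArg (B z) hab
      obtain rfl : b = 1 := by simpa [hvu, hu, hv] using congrArg (B v) hab
      have hus := congrArg (B u) hab
      simp only [zero_smul, one_smul, zero_add, map_add, map_smul, smul_eq_mul, huv, mul_zero,
        add_zero] at hus
      have : 2 * s * B u u = 0 := by linear_combination -hus
      simp_all
    · ext W
      constructor
      · rintro ⟨w, ⟨hw, hzw, hww⟩, rfl⟩
        obtain ⟨a, b, rfl⟩ := Submodule.mem_span_pair.mp (hspan w hzw)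
        rw [hval] at hww
        have hfac : (a * B u u - b * s) * (a * B u u + b * s) = 0 := by
          linear_combination B u u * hww + b ^ 2 * hs
        have hscale : B u u • (a • u + b • v) = (a * B u u - b * s) • u + b • (s • u + B u u • v) := by
          module
        have hscale' : B u u • (a • u + b • v) =
            (a * B u u + b * s) • u + b • ((-s) • u + B u u • v) := by
          module
        have hb : b ≠ 0 := by
          rintro rfl
          simp_all
        have hspan_eq {x y : V} {k l : K} (hk : k ≠ 0) (hl : l ≠ 0) (h : k • x = l • y) :
            Submodule.span K {z, x} = Submodule.span K {z, y} := by
          rw [Submodule.span_insert, Submodule.span_insert,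
            ← Submodule.span_singleton_smul_eq hk.isUnit x, h,
            Submodule.span_singleton_smul_eq hl.isUnit]
        rcases mul_eq_zero.mp hfac with h | h
        · left
          rw [h, zero_smul, zero_add] at hscale
          exact hspan_eq hu hb hscale
        · right
          rw [h, zero_smul, zero_add] at hscale'
          exact hspan_eq hu hb hscale'
      · rintro (rfl | rfl)
        · exact ⟨_, ⟨hne s, by simp [hzu, hzv], by rw [hval]; linear_combination -B u u * hs⟩, rfl⟩
        · exact ⟨_, ⟨hne (-s), by simp [hzu, hzv], by rw [hval]; linear_combination -B u u * hs⟩,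
            rfl⟩
  · convert Set.ncard_empty (Submodule K V)
    rw [Set.image_eq_empty, Set.eq_empty_iff_forall_notMem]
    rintro w ⟨hw, hzw, hww⟩
    obtain ⟨a, b, rfl⟩ := Submodule.mem_span_pair.mp (hspan w hzw)
    rw [hval] at hww
    have hb : b ≠ 0 := by
      rintro rfl
      simp_all
    refine hsq ⟨a * B u u / b, ?_⟩
    field_simp
    linear_combination -hww

/-- The polar line of a nonisotropic vector in a nondegenerate three-dimensional space has an
orthogonal basis of nonisotropic vectors. -/
theorem exists_orthogonal_pair [FiniteDimensional K V] (h2 : (2 : K) ≠ 0) (hB : B.IsSymm)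
    (hnd : B.Nondegenerate) (hV : Module.finrank K V = 3) {z : V} (hz : B z z ≠ 0) :
    ∃ u v : V, B u u ≠ 0 ∧ B v v ≠ 0 ∧ B z u = 0 ∧ B z v = 0 ∧ B u v = 0 ∧
      ∀ w, B z w = 0 → w ∈ Submodule.span K {u, v} := by
  have : Invertible (2 : K) := invertibleOfNonzero h2
  have hker : Module.finrank K (LinearMap.ker (B z)) = 2 := by
    have := Module.Dual.finrank_ker_add_one_of_ne_zero (f := B z) (by
      intro h
      simp [h] at hz)
    omega
  obtain ⟨b, hb⟩ : ∃ b : Module.Basis (Fin 2) K (LinearMap.ker (B z)),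
      (B.restrict (LinearMap.ker (B z))).IsOrthoᵢ b := by
    have h := LinearMap.BilinForm.exists_orthogonal_basis
      (B := B.restrict (LinearMap.ker (B z))) ⟨fun x y => hB.eq x y⟩
    rwa [hker] at h
  have hrepr (w : V) (hw : B z w = 0) : ∃ c d : K, c • (b 0 : V) + d • (b 1 : V) = w := by
    have h := congrArg Subtype.val (b.sum_repr ⟨w, hw⟩)
    rw [Fin.sum_univ_two] at h
    exact ⟨_, _, h⟩
  have hperp (x : LinearMap.ker (B z)) (h0 : B x (b 0) = 0) (h1 : B x (b 1) = 0) : x = 0 := by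
    refine Subtype.ext (hnd.1 _ fun y => ?_)
    have hxz : B x z = 0 := hB.eq z x ▸ x.2
    obtain ⟨c, d, h⟩ := hrepr (y - (B z y / B z z) • z) (by simp [hz])
    rw [← sub_add_cancel y ((B z y / B z z) • z), ← h]
    simp [h0, h1, hxz]
  have h01 : B (b 0) (b 1) = 0 := hb (by decide : (0 : Fin 2) ≠ 1)
  have h10 : B (b 1) (b 0) = 0 := hb (by decide : (1 : Fin 2) ≠ 0)
  exact ⟨b 0, b 1, fun h => b.ne_zero 0 (hperp _ h h01), fun h => b.ne_zero 1 (hperp _ h10 h),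
    (b 0).2, (b 1).2, h01, fun w hw => Submodule.mem_span_pair.mpr (hrepr w hw)⟩

end BilinForm

/-- **Lemma 3.1(2).** Let `q` be an odd prime power and `z ∈ F_{q^3}` with
`Tr_{q^3/q}(z²) ≠ 0` (so `⟨z⟩` is a point of `PG(2,q)` off the conic `Tr(y²) = 0`). Then
`⟨z⟩` lies on exactly two tangent lines of the conic if `sgn(Tr(z²)) = ε`, and on no tangent
line if `sgn(Tr(z²)) = -ε`, where `ε = 1` for `q ≡ 1 (mod 4)` and `ε = -1` for
`q ≡ 3 (mod 4)`. -/
theorem exterior_interior_points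
    (q : ℕ) (hq : IsPrimePow q) (hqodd : Odd q)
    (K M3 : Type) [Field K] [Fintype K] [Field M3] [Fintype M3] [Algebra K M3]
    (hK : Fintype.card K = q) (hM3 : Fintype.card M3 = q ^ 3)
    (z : M3) (hz : z ≠ 0) (hzoff : Algebra.trace K M3 (z ^ 2) ≠ 0) :
    (IsSquare (Algebra.trace K M3 (z ^ 2)) →
      {W : Submodule K M3 | Module.finrank K W = 2 ∧ Submodule.span K {z} ≤ W ∧
        {P : Submodule K M3 | Module.finrank K P = 1 ∧ P ≤ W ∧ ∃ y : M3,
          P = Submodule.span K {y} ∧ Algebra.trace K M3 (y ^ 2) = 0}.ncard = 1}.ncard =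
        if q % 4 = 1 then 2 else 0) ∧
    (¬ IsSquare (Algebra.trace K M3 (z ^ 2)) →
      {W : Submodule K M3 | Module.finrank K W = 2 ∧ Submodule.span K {z} ≤ W ∧
        {P : Submodule K M3 | Module.finrank K P = 1 ∧ P ≤ W ∧ ∃ y : M3,
          P = Submodule.span K {y} ∧ Algebra.trace K M3 (y ^ 2) = 0}.ncard = 1}.ncard =
        if q % 4 = 1 then 0 else 2) := by
  have hq1 : 1 < q := hq.one_lt
  have hfr : Module.finrank K M3 = 3 := by
    have h := Module.card_eq_pow_finrank (K := K) (V := M3)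
    rw [hM3, hK] at h
    exact (Nat.pow_right_injective hq1 h).symm
  have h2 : (2 : K) ≠ 0 := by
    apply Ring.two_ne_zero
    intro h
    have := FiniteField.even_card_of_char_two h
    rw [hK] at this
    rw [Nat.odd_iff] at hqodd
    omega
  have hB := Algebra.traceForm_isSymm K (S := M3)
  have hz' : Algebra.traceForm K M3 z z ≠ 0 := by rwa [Algebra.traceForm_apply, ← sq]
  obtain ⟨u, v, hu, hv, hzu, hzv, huv, hspan⟩ :=
    exists_orthogonal_pair h2 hB (traceForm_nondegenerate K M3) hfr hz'
  have hcount := ncard_tangent_eq_ite h2 hB hz' hu hv hzu hzv huv hspan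
  have hdet := isSquare_det_trace_mul hfr (by decide) ![z, u, v]
  have hvu : Algebra.traceForm K M3 v u = 0 := hB.eq u v ▸ huv
  have huz : Algebra.traceForm K M3 u z = 0 := hB.eq z u ▸ hzu
  have hvz : Algebra.traceForm K M3 v z = 0 := hB.eq z v ▸ hzv
  simp only [Matrix.det_fin_three, Matrix.of_apply, Matrix.cons_val, ← Algebra.traceForm_apply,
    hzu, hzv, huv, huz, hvz, hvu, mul_zero, zero_mul, sub_zero, add_zero] at hdet
  simp only [Algebra.traceForm_apply] at *
  simp only [← sq] at *
  rw [hcount]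
  have hneg1 := FiniteField.isSquare_neg_one_iff (F := K)
  rw [hK] at hneg1
  rw [mul_assoc, FiniteField.isSquare_mul_iff hzoff (mul_ne_zero hu hv)] at hdet
  have hneg : IsSquare (-(Algebra.trace K M3 (u ^ 2) * Algebra.trace K M3 (v ^ 2))) ↔
      (q % 4 ≠ 3 ↔ IsSquare (Algebra.trace K M3 (z ^ 2))) := by
    rw [← neg_one_mul, FiniteField.isSquare_mul_iff (neg_ne_zero.mpr one_ne_zero)
      (mul_ne_zero hu hv), hneg1, hdet]
  have hmod : q % 4 ≠ 3 ↔ q % 4 = 1 := by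
    rw [Nat.odd_iff] at hqodd
    omega
  simp only [hneg, hmod]
  constructor <;> intro h <;> by_cases h1 : q % 4 = 1 <;> simp [h, h1]
end

section
/- Let q be an odd prime power and let ψ be the canonical additive character of F_{q^3}. Then for every nonzero a ∈ F_{q^3}, the character sum Σ ψ(ax), taken over all nonzero x ∈ F_{q^3} with Tr_{q^3/q}(x^2) = 0, equals: -1 if Tr_{q^3/q}(a^2) = 0; -1 + εq if Tr_{q^3/q}(a^2) is a nonzero square in F_q; and -1 - εq if Tr_{q^3/q}(a^2) is a nonsquare in F_q. Here ε = 1 if q ≡ 1 (mod 4) and ε = -1 if q ≡ 3 (mod 4). -/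
open scoped Classical

/-- The quadratic character of a finite field, with complex values. -/
noncomputable def complexQuadraticChar (K : Type*) [Field K] [Fintype K] : MulChar K ℂ :=
  (quadraticChar K).ringHomComp (Int.castRingHom ℂ)

section QuadraticGaussSums

variable {K : Type*} [Field K] [Fintype K]

theorem complexQuadraticChar_apply (a : K) :
    complexQuadraticChar K a = ((quadraticChar K a : ℤ) : ℂ) := rfl

theorem complexQuadraticChar_sq {a : K} (ha : a ≠ 0) : complexQuadraticChar K a ^ 2 = 1 := by
  rw [complexQuadraticChar_apply]
  exact_mod_cast quadraticChar_sq_one ha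

theorem complexQuadraticChar_ne_one (h2 : ringChar K ≠ 2) : complexQuadraticChar K ≠ 1 :=
  (MulChar.ringHomComp_ne_one_iff (RingHom.injective_int _)).2 (quadraticChar_ne_one h2)

theorem gaussSum_complexQuadraticChar_sq (h2 : ringChar K ≠ 2) {χ : AddChar K ℂ}
    (hχ : χ.IsPrimitive) :
    gaussSum (complexQuadraticChar K) χ ^ 2 = complexQuadraticChar K (-1) * Fintype.card K :=
  gaussSum_sq (complexQuadraticChar_ne_one h2) ((quadraticChar_isQuadratic K).comp _) hχ

theorem sum_complexQuadraticChar_mul_addChar (h2 : ringChar K ≠ 2) (χ : AddChar K ℂ) (c : K) :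
    ∑ y, complexQuadraticChar K y * χ (c * y) =
      complexQuadraticChar K c * gaussSum (complexQuadraticChar K) χ := by
  rcases eq_or_ne c 0 with rfl | hc
  · rw [MulChar.map_zero, zero_mul]
    simpa using MulChar.sum_eq_zero_of_ne_one (complexQuadraticChar_ne_one h2)
  · have h := gaussSum_mulShift (complexQuadraticChar K) χ (Units.mk0 c hc)
    simp only [Units.val_mk0] at h
    rw [← h, ← mul_assoc, ← pow_two, complexQuadraticChar_sq hc, one_mul]
    simp [gaussSum, AddChar.mulShift_apply]

theorem sum_comp_sq_eq_sum (h2 : ringChar K ≠ 2) (f : K → ℂ) :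
    ∑ x, f (x ^ 2) = ∑ y, (complexQuadraticChar K y + 1) * f y := by
  rw [← Finset.sum_fiberwise Finset.univ (fun x : K => x ^ 2)]
  refine Finset.sum_congr rfl fun y _ => ?_
  rw [Finset.sum_congr rfl fun x hx => by rw [(Finset.mem_filter.1 hx).2], Finset.sum_const,
    nsmul_eq_mul]
  congr 1
  have h := quadraticChar_card_sqrts h2 y
  rw [complexQuadraticChar_apply]
  have h' : ({x | x ^ 2 = y} : Set K).toFinset = Finset.univ.filter (fun x : K => x ^ 2 = y) := by
    ext; simp
  rw [h'] at h
  exact_mod_cast h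

theorem sum_addChar_mul_sq (h2 : ringChar K ≠ 2) {χ : AddChar K ℂ} (hχ : χ.IsPrimitive)
    {c : K} (hc : c ≠ 0) :
    ∑ x, χ (c * x ^ 2) =
      complexQuadraticChar K c * gaussSum (complexQuadraticChar K) χ := by
  rw [sum_comp_sq_eq_sum h2 fun y => χ (c * y)]
  simp only [add_mul, one_mul, Finset.sum_add_distrib]
  rw [sum_complexQuadraticChar_mul_addChar h2]
  have := AddChar.sum_mulShift c hχ
  simp only [mul_comm c]
  rw [this]
  simp [hc]

theorem sum_addChar_quadratic (h2 : ringChar K ≠ 2) {χ : AddChar K ℂ} (hχ : χ.IsPrimitive)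
    {c : K} (hc : c ≠ 0) (b : K) :
    ∑ x, χ (c * x ^ 2 + b * x) = complexQuadraticChar K c *
      gaussSum (complexQuadraticChar K) χ * χ (-(b ^ 2 / (4 * c))) := by
  have h2' : (2 : K) ≠ 0 := Ring.two_ne_zero h2
  have h4 : (4 : K) ≠ 0 := by
    rw [show (4 : K) = 2 * 2 by norm_num]; exact mul_ne_zero h2' h2'
  rw [← sum_addChar_mul_sq h2 hχ hc, Finset.sum_mul,
    ← Equiv.sum_comp (Equiv.addRight (-(b / (2 * c))))]
  refine Finset.sum_congr rfl fun x _ => ?_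
  rw [← AddChar.map_add_eq_mul]
  congr 1
  simp only [Equiv.coe_addRight]
  field_simp
  ring

theorem sum_complexQuadraticChar_mul_addChar_div (h2 : ringChar K ≠ 2) (χ : AddChar K ℂ) (c : K) :
    ∑ t, complexQuadraticChar K t * χ (-(c / (4 * t))) =
      complexQuadraticChar K (-c) * gaussSum (complexQuadraticChar K) χ := by
  have h2' : (2 : K) ≠ 0 := Ring.two_ne_zero h2
  rw [← sum_complexQuadraticChar_mul_addChar h2]
  have h4 : (4 : K) ≠ 0 := by
    rw [show (4 : K) = 2 * 2 by norm_num]; exact mul_ne_zero h2' h2'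
  have hη4 : complexQuadraticChar K 4 = 1 := by
    rw [show (4 : K) = 2 ^ 2 by norm_num, map_pow, complexQuadraticChar_sq h2']
  let e : K ≃ K := Function.Involutive.toPerm (fun t : K => (4 * t)⁻¹) fun t => by
    field_simp
  rw [← Equiv.sum_comp e]
  refine Finset.sum_congr rfl fun t _ => ?_
  have he : e t = (4 * t)⁻¹ := rfl
  rw [he]
  congr 1
  · rcases eq_or_ne t 0 with rfl | ht
    · simp
    · have h1 : complexQuadraticChar K ((4 * t)⁻¹) * complexQuadraticChar K (4 * t) = 1 := by
        rw [← map_mul, inv_mul_cancel₀ (mul_ne_zero h4 ht), map_one]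
      rw [map_mul, hη4, one_mul] at h1
      have hs := complexQuadraticChar_sq ht
      linear_combination complexQuadraticChar K t * h1 - complexQuadraticChar K ((4 * t)⁻¹) * hs
  · congr 1
    rcases eq_or_ne t 0 with rfl | ht
    · simp
    · field_simp

end QuadraticGaussSums

section TraceForm

variable {K L : Type*} [Field K] [Field L] [Algebra K L]

theorem sum_trace_mul_basis_sq_div {b : Module.Basis (Fin 3) K L}
    (hb : ∀ i j, i ≠ j → Algebra.trace K L (b i * b j) = 0)
    (hb0 : ∀ i, Algebra.trace K L (b i ^ 2) ≠ 0) (a : L) :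
    ∑ i, Algebra.trace K L (a * b i) ^ 2 / Algebra.trace K L (b i ^ 2) =
      Algebra.trace K L (a ^ 2) := by
  have hcoord : ∀ i, Algebra.trace K L (a * b i) = b.repr a i * Algebra.trace K L (b i ^ 2) := by
    intro i
    conv_lhs => rw [← b.sum_repr a]
    rw [Finset.sum_mul, map_sum, Finset.sum_eq_single i]
    · simp [pow_two]
    · intro j _ hj
      simp [hb j i hj]
    · simp
  have htr : Algebra.trace K L (a ^ 2) = ∑ i, b.repr a i * Algebra.trace K L (a * b i) := by
    conv_lhs => rw [pow_two]; arg 2; arg 2; rw [← b.sum_repr a]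
    rw [Finset.mul_sum, map_sum]
    exact Finset.sum_congr rfl fun i _ => by rw [mul_smul_comm, map_smul, smul_eq_mul]
  rw [htr]
  refine Finset.sum_congr rfl fun i _ => ?_
  rw [hcoord]
  have := hb0 i
  field_simp

variable [Fintype K] [Fintype L]

theorem exists_orthogonal_basis_trace (h2 : ringChar K ≠ 2) (h3 : Module.finrank K L = 3) :
    ∃ b : Module.Basis (Fin 3) K L, (∀ i j, i ≠ j → Algebra.trace K L (b i * b j) = 0) ∧
      ∀ i, Algebra.trace K L (b i ^ 2) ≠ 0 := by
  have : Invertible (2 : K) := invertibleOfNonzero (Ring.two_ne_zero h2)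
  obtain ⟨v, hv⟩ := LinearMap.BilinForm.exists_orthogonal_basis
    (B := Algebra.traceForm K L) ⟨(Algebra.traceForm_isSymm K).eq⟩
  refine ⟨v.reindex (finCongr h3), fun i j hij => ?_, fun i => ?_⟩
  · simp only [Module.Basis.reindex_apply]
    exact hv fun h => hij ((finCongr h3).symm.injective h)
  · have := LinearMap.BilinForm.iIsOrtho.not_isOrtho_basis_self_of_nondegenerate hv
      (traceForm_nondegenerate K L) ((finCongr h3).symm i)
    rw [Algebra.traceForm_apply, ← pow_two] at this
    rwa [Module.Basis.reindex_apply]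

/-- The trace form of a cubic extension of finite fields has square discriminant, because the
Frobenius permutes the three conjugates evenly. -/
theorem isSquare_prod_trace_sq (h2 : ringChar K ≠ 2) (h3 : Module.finrank K L = 3)
    {b : Fin 3 → L} (hb : ∀ i j, i ≠ j → Algebra.trace K L (b i * b j) = 0) :
    IsSquare (∏ i, Algebra.trace K L (b i ^ 2)) := by
  set d : K := ∏ i, Algebra.trace K L (b i ^ 2) with hd
  rcases eq_or_ne d 0 with h0 | h0
  · rw [h0]; exact IsSquare.zero
  let M : Matrix (Fin 3) (Fin 3) L := Matrix.of fun i j => b j ^ Fintype.card K ^ (i : ℕ)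
  have hM : M.transpose * M =
      Matrix.diagonal fun i => algebraMap K L (Algebra.trace K L (b i ^ 2)) := by
    ext i j
    have : (M.transpose * M) i j = algebraMap K L (Algebra.trace K L (b i * b j)) := by
      rw [FiniteField.algebraMap_trace_eq_sum_pow, h3, Matrix.mul_apply,
        Finset.sum_range, Nat.card_eq_fintype_card]
      exact Finset.sum_congr rfl fun k _ => by simp [M, mul_pow]
    rw [this]
    rcases eq_or_ne i j with rfl | hij
    · simp [pow_two]
    · simp [hb i j hij, hij]
  have hdet : M.det ^ 2 = algebraMap K L d := by
    have := congrArg Matrix.det hM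
    rw [Matrix.det_mul, Matrix.det_transpose, Matrix.det_diagonal, ← map_prod] at this
    rw [pow_two, this]
  have hfrob : M.det ^ Fintype.card K = M.det := by
    have hcard : Fintype.card L = Fintype.card K ^ 3 := by
      rw [Module.card_eq_pow_finrank (K := K) (V := L), h3]
    have hφ : ∀ x, FiniteField.frobeniusAlgHom K L x = x ^ Fintype.card K := fun x => by
      rw [FiniteField.coe_frobeniusAlgHom]
    have hcycle : ∀ x : L, ((x ^ Fintype.card K) ^ Fintype.card K) ^ Fintype.card K = x :=
      fun x => by
        rw [← pow_mul, ← pow_mul, show Fintype.card K * (Fintype.card K * Fintype.card K) =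
          Fintype.card L by rw [hcard]; ring, FiniteField.pow_card]
    rw [← hφ, Matrix.det_fin_three]
    simp only [M, Matrix.of_apply, map_sub, map_add, map_mul]
    simp only [hφ, Fin.val_zero, Fin.val_one, Fin.val_two, pow_zero, pow_one,
      pow_two (Fintype.card K), pow_mul, hcycle]
    ring
  have hdet0 : M.det ≠ 0 := fun h => by
    rw [h] at hdet
    exact h0 ((map_eq_zero (algebraMap K L)).1 (by rw [← hdet]; simp))
  rw [FiniteField.isSquare_iff h2 h0]
  apply (algebraMap K L).injective
  have hodd : 2 * (Fintype.card K / 2) + 1 = Fintype.card K := by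
    have := FiniteField.odd_card_of_char_ne_two h2
    omega
  rw [map_pow, ← hdet, ← pow_mul, map_one]
  refine mul_right_cancel₀ hdet0 ?_
  rw [← pow_succ, hodd, hfrob, one_mul]

theorem sum_addChar_trace_quadratic (χ : AddChar K ℂ) {b : Module.Basis (Fin 3) K L}
    (hb : ∀ i j, i ≠ j → Algebra.trace K L (b i * b j) = 0) (t : K) (a : L) :
    ∑ x : L, χ (t * Algebra.trace K L (x ^ 2) + Algebra.trace K L (a * x)) =
      ∏ i, ∑ y : K, χ (t * Algebra.trace K L (b i ^ 2) * y ^ 2 +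
        Algebra.trace K L (a * b i) * y) := by
  rw [Finset.prod_univ_sum, Fintype.piFinset_univ, ← Equiv.sum_comp b.equivFun.symm.toEquiv]
  refine Finset.sum_congr rfl fun y _ => ?_
  have h01 := hb 0 1 (by decide)
  have h02 := hb 0 2 (by decide)
  have h12 := hb 1 2 (by decide)
  have hsq : (y 0 • b 0 + y 1 • b 1 + y 2 • b 2) ^ 2 =
      y 0 ^ 2 • b 0 ^ 2 + y 1 ^ 2 • b 1 ^ 2 + y 2 ^ 2 • b 2 ^ 2 + (2 * y 0 * y 1) • (b 0 * b 1) +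
        (2 * y 0 * y 2) • (b 0 * b 2) + (2 * y 1 * y 2) • (b 1 * b 2) := by
    simp only [Algebra.smul_def, map_mul, map_pow, map_ofNat]
    ring
  simp only [LinearEquiv.coe_toEquiv, Module.Basis.equivFun_symm_apply, Fin.sum_univ_three,
    Fin.prod_univ_three, hsq, ← AddChar.map_add_eq_mul, mul_add, mul_smul_comm, map_add, map_smul,
    h01, h02, h12, smul_eq_mul]
  congr 1
  ring

theorem sum_addChar_trace_cone (h2 : ringChar K ≠ 2) (h3 : Module.finrank K L = 3)
    {χ : AddChar K ℂ} (hχ : χ.IsPrimitive) {a : L} (ha : a ≠ 0) :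
    ∑ x ∈ Finset.univ.filter (fun x : L => Algebra.trace K L (x ^ 2) = 0),
        χ (Algebra.trace K L (a * x)) =
      complexQuadraticChar K (-1) * Fintype.card K *
        complexQuadraticChar K (Algebra.trace K L (a ^ 2)) := by
  obtain ⟨b, hb, hb0⟩ := exists_orthogonal_basis_trace (L := L) h2 h3
  set η := complexQuadraticChar K with hη
  set G := gaussSum η χ with hG
  have hq : (Fintype.card K : ℂ) ≠ 0 := by exact_mod_cast Fintype.card_ne_zero
  have hdisc : ∏ i, η (Algebra.trace K L (b i ^ 2)) = 1 := by
    have h0 : ∏ i, Algebra.trace K L (b i ^ 2) ≠ 0 := Finset.prod_ne_zero_iff.2 fun i _ => hb0 i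
    rw [← map_prod, hη, complexQuadraticChar_apply,
      (quadraticChar_one_iff_isSquare h0).2 (isSquare_prod_trace_sq h2 h3 hb), Int.cast_one]
  have hterm : ∀ t : K,
      ∑ x : L, χ (t * Algebra.trace K L (x ^ 2) + Algebra.trace K L (a * x)) =
        G ^ 3 * (η t * χ (-(Algebra.trace K L (a ^ 2) / (4 * t)))) := by
    intro t
    rw [sum_addChar_trace_quadratic χ hb]
    rcases eq_or_ne t 0 with rfl | ht
    · obtain ⟨i, hi⟩ : ∃ i, Algebra.trace K L (a * b i) ≠ 0 := by
        by_contra! h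
        refine ha ((traceForm_nondegenerate K L).1 a fun y => ?_)
        rw [← b.sum_repr y, map_sum]
        exact Finset.sum_eq_zero fun i _ => by
          rw [map_smul, Algebra.traceForm_apply, h, smul_zero]
      rw [MulChar.map_zero, zero_mul, mul_zero]
      refine Finset.prod_eq_zero (Finset.mem_univ i) ?_
      have := AddChar.sum_mulShift (Algebra.trace K L (a * b i)) hχ
      simpa [hi, mul_comm] using this
    · rw [Finset.prod_congr rfl fun i _ =>
        sum_addChar_quadratic h2 hχ (mul_ne_zero ht (hb0 i)) _]
      have hexp : -(Algebra.trace K L (a ^ 2) / (4 * t)) =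
          ∑ i, -(Algebra.trace K L (a * b i) ^ 2 / (4 * (t * Algebra.trace K L (b i ^ 2)))) := by
        rw [← sum_trace_mul_basis_sq_div hb hb0 a, Finset.sum_div, ← Finset.sum_neg_distrib]
        refine Finset.sum_congr rfl fun i _ => ?_
        rw [div_div]
        congr 2
        ring
      rw [hexp]
      have hηt := complexQuadraticChar_sq ht
      simp only [Fin.prod_univ_three] at hdisc
      simp only [Fin.prod_univ_three, Fin.sum_univ_three, AddChar.map_add_eq_mul, map_mul,
        ← hη, ← hG] at hηt ⊢
      generalize η (Algebra.trace K L (b 0 ^ 2)) = d0 at *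
      generalize η (Algebra.trace K L (b 1 ^ 2)) = d1 at *
      generalize η (Algebra.trace K L (b 2 ^ 2)) = d2 at *
      generalize χ _ = c0
      generalize χ _ = c1
      generalize χ _ = c2
      linear_combination G ^ 3 * c0 * c1 * c2 * η t * hηt * (d0 * d1 * d2) +
        G ^ 3 * c0 * c1 * c2 * η t * hdisc
  have hG2 : G ^ 2 = η (-1) * Fintype.card K := gaussSum_complexQuadraticChar_sq h2 hχ
  have hη1 : η (-1) ^ 2 = 1 := complexQuadraticChar_sq (neg_ne_zero.2 one_ne_zero)
  apply mul_left_cancel₀ hq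
  have hdetect : (Fintype.card K : ℂ) *
      ∑ x ∈ Finset.univ.filter (fun x : L => Algebra.trace K L (x ^ 2) = 0),
        χ (Algebra.trace K L (a * x)) =
      ∑ t : K, ∑ x : L, χ (t * Algebra.trace K L (x ^ 2) + Algebra.trace K L (a * x)) := by
    rw [Finset.sum_comm, Finset.mul_sum, Finset.sum_filter]
    refine Finset.sum_congr rfl fun x _ => ?_
    simp only [AddChar.map_add_eq_mul]
    rw [← Finset.sum_mul, AddChar.sum_mulShift _ hχ]
    split_ifs <;> simp
  rw [hdetect, Finset.sum_congr rfl fun t _ => hterm t, ← Finset.mul_sum,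
    sum_complexQuadraticChar_mul_addChar_div h2, ← hη, ← hG, ← neg_one_mul, map_mul]
  linear_combination (η (-1) * η (Algebra.trace K L (a ^ 2)) * (G ^ 2 + η (-1) * Fintype.card K)) *
    hG2 + η (-1) * η (Algebra.trace K L (a ^ 2)) * Fintype.card K ^ 2 * hη1

end TraceForm

/-- **Equation (3.5).** Let `q` be an odd prime power. The canonical additive character sums
of the cone `{x ∈ F_{q^3}^× : Tr_{q^3/q}(x²) = 0}` are: `-1` if `Tr(a²) = 0`, `-1 + εq` if
`Tr(a²)` is a nonzero square, and `-1 - εq` if `Tr(a²)` is a nonsquare, where `ε = 1` for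
`q ≡ 1 (mod 4)` and `ε = -1` for `q ≡ 3 (mod 4)`. -/
theorem cone_character_values
    (p n q : ℕ) (hp : p.Prime) (hn : 0 < n) (hqpn : q = p ^ n) (hqodd : Odd q)
    (K M3 : Type) [Field K] [Fintype K] [Field M3] [Fintype M3] [Algebra K M3]
    [Algebra (ZMod p) M3]
    (hK : Fintype.card K = q) (hM3 : Fintype.card M3 = q ^ 3) :
    ∀ a : M3, a ≠ 0 →
      (Algebra.trace K M3 (a ^ 2) = 0 →
        (∑ x ∈ Finset.univ.filter (fun x : M3 => x ≠ 0 ∧ Algebra.trace K M3 (x ^ 2) = 0),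
          Complex.exp (2 * Real.pi * Complex.I *
            ((Algebra.trace (ZMod p) M3 (a * x)).val : ℂ) / p)) = -1) ∧
      (Algebra.trace K M3 (a ^ 2) ≠ 0 → IsSquare (Algebra.trace K M3 (a ^ 2)) →
        (∑ x ∈ Finset.univ.filter (fun x : M3 => x ≠ 0 ∧ Algebra.trace K M3 (x ^ 2) = 0),
          Complex.exp (2 * Real.pi * Complex.I *
            ((Algebra.trace (ZMod p) M3 (a * x)).val : ℂ) / p)) =
          -1 + (if q % 4 = 1 then (1 : ℂ) else -1) * q) ∧
      (¬ IsSquare (Algebra.trace K M3 (a ^ 2)) →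
        (∑ x ∈ Finset.univ.filter (fun x : M3 => x ≠ 0 ∧ Algebra.trace K M3 (x ^ 2) = 0),
          Complex.exp (2 * Real.pi * Complex.I *
            ((Algebra.trace (ZMod p) M3 (a * x)).val : ℂ) / p)) =
          -1 - (if q % 4 = 1 then (1 : ℂ) else -1) * q) := by
  intro a ha
  have : Fact p.Prime := ⟨hp⟩
  have hcharM : CharP M3 p := charP_of_injective_algebraMap (algebraMap (ZMod p) M3).injective p
  have hcharK : CharP K p := (Algebra.charP_iff K M3 p).2 hcharM
  have h2 : ringChar K ≠ 2 := by
    rw [ringChar.eq K p]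
    rintro rfl
    rw [hqpn] at hqodd
    exact absurd (Nat.odd_pow_iff hn.ne' |>.1 hqodd) (by decide)
  have h3 : Module.finrank K M3 = 3 := by
    have h := Module.card_eq_pow_finrank (K := K) (V := M3)
    rw [hM3, hK] at h
    exact (Nat.pow_right_injective (hK ▸ Fintype.one_lt_card (α := K)) h).symm
  let _ : Algebra (ZMod p) K := ZMod.algebra K p
  have : IsScalarTower (ZMod p) K M3 :=
    IsScalarTower.of_algebraMap_eq' (Subsingleton.elim _ _)
  let χ : AddChar K ℂ := (ZMod.stdAddChar (N := p)).compAddMonoidHom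
    (Algebra.trace (ZMod p) K).toAddMonoidHom
  have hχ : χ.IsPrimitive := by
    apply AddChar.IsPrimitive.of_ne_one
    intro h
    obtain ⟨y, hy⟩ := Algebra.trace_surjective (ZMod p) K 1
    have h1 : ZMod.stdAddChar (1 : ZMod p) = 1 := by
      rw [← hy]
      exact DFunLike.congr_fun h y
    rw [← AddChar.map_zero_eq_one (ZMod.stdAddChar (N := p))] at h1
    exact one_ne_zero (ZMod.injective_stdAddChar h1)
  have hterm : ∀ x : M3, Complex.exp (2 * Real.pi * Complex.I *
      ((Algebra.trace (ZMod p) M3 (a * x)).val : ℂ) / p) = χ (Algebra.trace K M3 (a * x)) := by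
    intro x
    rw [← ZMod.toCircle_apply, ← ZMod.stdAddChar_apply, ← Algebra.trace_trace (S := K)]
    rfl
  have hsum : ∑ x ∈ Finset.univ.filter (fun x : M3 => x ≠ 0 ∧ Algebra.trace K M3 (x ^ 2) = 0),
      Complex.exp (2 * Real.pi * Complex.I *
        ((Algebra.trace (ZMod p) M3 (a * x)).val : ℂ) / p) =
      -1 + (if q % 4 = 1 then (1 : ℂ) else -1) * q *
        complexQuadraticChar K (Algebra.trace K M3 (a ^ 2)) := by
    have hε : complexQuadraticChar K (-1) = if q % 4 = 1 then (1 : ℂ) else -1 := by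
      rw [complexQuadraticChar_apply, quadraticChar_neg_one h2, ZMod.χ₄_nat_eq_if_mod_four, hK,
        if_neg (by have := Nat.odd_iff.1 hqodd; omega)]
      split_ifs <;> simp
    have hcone := sum_addChar_trace_cone h2 h3 hχ ha
    rw [hε, hK] at hcone
    rw [← hcone, Finset.sum_congr rfl fun x _ => hterm x]
    have herase : Finset.univ.filter (fun x : M3 => x ≠ 0 ∧ Algebra.trace K M3 (x ^ 2) = 0) =
        (Finset.univ.filter (fun x : M3 => Algebra.trace K M3 (x ^ 2) = 0)).erase 0 := by
      ext; simp
    rw [herase, Finset.sum_erase_eq_sub (by simp), mul_zero, map_zero, AddChar.map_zero_eq_one]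
    ring
  rw [hsum, complexQuadraticChar_apply]
  refine ⟨fun h => ?_, fun h hs => ?_, fun hs => ?_⟩
  · simp [h]
  · rw [(quadraticChar_one_iff_isSquare h).2 hs, Int.cast_one, mul_one]
  · rw [quadraticChar_neg_one_iff_not_isSquare.2 hs]
    push_cast
    ring
end

section
/- Let q be an odd prime power and let ψ be the canonical additive character of F_{q^6}. Then for every nonzero b ∈ F_{q^6}, the character sum Σ ψ(bx), taken over all nonzero x ∈ F_{q^6} with Tr_{q^3/q}(x^{q^3+1}) = 0, equals -q^3 + q^2 - 1 if Tr_{q^3/q}(b^{q^3+1}) = 0, and equals q^2 - 1 otherwise. -/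
open scoped Classical

namespace AddChar

/-- The pullback of an additive character of `F` along the trace of an extension `E / F`. -/
noncomputable def compTrace {F : Type*} (E : Type*) [Field F] [Field E] [Algebra F E]
    (ψ : AddChar F ℂ) : AddChar E ℂ :=
  ψ.compAddMonoidHom (Algebra.trace F E).toAddMonoidHom

variable {F L : Type*} [Field F] [Field L] [Algebra F L]

@[simp]
theorem compTrace_apply (ψ : AddChar F ℂ) (x : L) :
    ψ.compTrace L x = ψ (Algebra.trace F L x) := rfl

theorem IsPrimitive.compTrace [Finite L] {ψ : AddChar F ℂ} (hψ : ψ.IsPrimitive) :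
    (ψ.compTrace L).IsPrimitive := by
  refine IsPrimitive.of_ne_one fun h ↦ ?_
  refine hψ one_ne_zero ?_
  ext y
  obtain ⟨x, rfl⟩ := Algebra.trace_surjective F L y
  simpa using DFunLike.congr_fun h x

/-- Orthogonality of the additive characters of the ground field. -/
theorem IsPrimitive.sum_mul_eq_ite [Fintype F] {ψ : AddChar F ℂ} (hψ : ψ.IsPrimitive) (a : F) :
    ∑ t : F, ψ (t * a) = if a = 0 then (Fintype.card F : ℂ) else 0 := by
  simpa using sum_mulShift a hψ

end AddChar

namespace FiniteField

theorem nonempty_algHom_of_card_eq_pow {K L : Type*} [Field K] [Field L] [Fintype K] [Fintype L]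
    {p m r : ℕ} [Fact p.Prime] [Algebra (ZMod p) K]
    [Algebra (ZMod p) L] (hL : Fintype.card L = p ^ (m * r)) (hK : Fintype.card K = p ^ m) :
    Nonempty (K →ₐ[ZMod p] L) := by
  have hp := (Fact.out : p.Prime).two_le
  apply nonempty_algHom_of_finrank_dvd
  rw [← pow_finrank_eq_card p] at hL hK
  rw [Nat.pow_right_injective hp hL, Nat.pow_right_injective hp hK]
  exact dvd_mul_right _ _

theorem add_pow_card {K L : Type*} [Field K] [Fintype K] [Field L] [Algebra K L] (x y : L) :
    (x + y) ^ Fintype.card K = x ^ Fintype.card K + y ^ Fintype.card K :=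
  map_add (frobeniusAlgHom K L) x y

variable {F K L : Type*} [Field F] [Field K] [Field L] [Fintype F] [Fintype K] [Fintype L]
  [Algebra F K] [Algebra F L] [Algebra K L]

theorem algebraMap_norm_eq_mul_pow_card (h : Module.finrank K L = 2) (x : L) :
    algebraMap K L (Algebra.norm K x) = x * x ^ Fintype.card K := by
  simp [algebraMap_norm_eq_prod_pow, h, Finset.prod_range_succ]

theorem algebraMap_trace_eq_add_pow_card (h : Module.finrank K L = 2) (x : L) :
    algebraMap K L (Algebra.trace K L x) = x + x ^ Fintype.card K := by
  simp [algebraMap_trace_eq_sum_pow, h, Finset.sum_range_succ]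

theorem pow_card_pow_card (h : Module.finrank K L = 2) (x : L) :
    (x ^ Fintype.card K) ^ Fintype.card K = x := by
  rw [← pow_mul, ← sq, ← h, ← Module.card_eq_pow_finrank, FiniteField.pow_card]

theorem norm_add_eq (h : Module.finrank K L = 2) (x c : L) :
    Algebra.norm K (x + c) =
      Algebra.norm K x + Algebra.trace K L (x * c ^ Fintype.card K) + Algebra.norm K c := by
  apply (algebraMap K L).injective
  simp only [map_add, algebraMap_norm_eq_mul_pow_card h, algebraMap_trace_eq_add_pow_card h,
    add_pow_card, mul_pow, pow_card_pow_card h]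
  ring

/-- The quadratic Gauss sum of the norm form of a quadratic extension. -/
theorem sum_addChar_mul_norm (h : Module.finrank K L = 2) {ψ : AddChar K ℂ}
    (hψ : ψ.IsPrimitive) {k : K} (hk : k ≠ 0) :
    ∑ x : L, ψ (k * Algebra.norm K x) = -(Fintype.card K : ℂ) := by
  have key : ∀ y : K, y ≠ 0 →
      ∑ x : L, ψ (y * Algebra.norm K x) = ∑ x : L, ψ (k * Algebra.norm K x) := by
    intro y hy
    obtain ⟨u, hu⟩ := norm_surjective K L (y / k)
    have hu0 : u ≠ 0 := by
      rintro rfl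
      rw [Algebra.norm_zero] at hu
      exact div_ne_zero hy hk hu.symm
    rw [← Equiv.sum_comp (Equiv.mulLeft₀ u hu0) fun x ↦ ψ (k * Algebra.norm K x)]
    refine Finset.sum_congr rfl fun x _ ↦ ?_
    simp only [Equiv.mulLeft₀_apply, map_mul (Algebra.norm K), hu]
    congr 1
    field_simp
  have h1 : ∑ y : K, ∑ x : L, ψ (y * Algebra.norm K x) = Fintype.card K := by
    rw [Finset.sum_comm]
    simp [hψ.sum_mul_eq_ite]
  have h2 : ∑ y : K, ∑ x : L, ψ (y * Algebra.norm K x) =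
      (Fintype.card K : ℂ) ^ 2 +
        (Fintype.card K - 1) * ∑ x : L, ψ (k * Algebra.norm K x) := by
    rw [← Finset.add_sum_erase _ _ (Finset.mem_univ 0),
      Finset.sum_congr rfl fun y hy ↦ key y (Finset.ne_of_mem_erase hy), Finset.sum_const,
      Finset.card_erase_of_mem (Finset.mem_univ _), Finset.card_univ, nsmul_eq_mul,
      Nat.cast_sub Fintype.card_pos, Nat.cast_one]
    simp [Module.card_eq_pow_finrank (K := K) (V := L), h]
  have hq : (Fintype.card K : ℂ) - 1 ≠ 0 := by
    rw [sub_ne_zero]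
    exact_mod_cast Fintype.one_lt_card.ne'
  refine mul_left_cancel₀ hq ?_
  linear_combination h1 - h2

theorem sum_addChar_mul_norm_add_trace (h : Module.finrank K L = 2) {ψ : AddChar K ℂ}
    (hψ : ψ.IsPrimitive) {k : K} (hk : k ≠ 0) (b : L) :
    ∑ x : L, ψ (k * Algebra.norm K x + Algebra.trace K L (b * x)) =
      -(Fintype.card K : ℂ) * ψ (-(k⁻¹ * Algebra.norm K b)) := by
  set c : L := k⁻¹ • b ^ Fintype.card K
  have hc : c ^ Fintype.card K = k⁻¹ • b := by
    rw [smul_pow, FiniteField.pow_card, pow_card_pow_card h]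
  have hn : Algebra.norm K c = k⁻¹ ^ 2 * Algebra.norm K b := by
    apply (algebraMap K L).injective
    rw [algebraMap_norm_eq_mul_pow_card h, hc, map_mul, algebraMap_norm_eq_mul_pow_card h]
    simp only [c, Algebra.smul_def, map_pow]
    ring
  rw [← sum_addChar_mul_norm h hψ hk,
    ← Equiv.sum_comp (Equiv.addRight c) fun x ↦ ψ (k * Algebra.norm K x), Finset.sum_mul]
  refine Finset.sum_congr rfl fun x _ ↦ ?_
  rw [← AddChar.map_add_eq_mul, Equiv.coe_addRight, norm_add_eq h, hc, hn, mul_smul_comm,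
    map_smul, smul_eq_mul, mul_comm b]
  congr 1
  field_simp
  ring

/-- Values of the additive characters on the zeros of the quadratic form
`Tr_{K/F} ∘ N_{L/K}`, where `L / K` is a quadratic extension. -/
theorem card_mul_sum_trace_norm_eq_zero [IsScalarTower F K L] (h : Module.finrank K L = 2)
    {ψ : AddChar F ℂ} (hψ : ψ.IsPrimitive) {b : L} (hb : b ≠ 0) :
    (Fintype.card F : ℂ) *
        ∑ x : L with Algebra.trace F K (Algebra.norm K x) = 0, ψ (Algebra.trace F L (b * x)) =
      -(Fintype.card K : ℂ) *
        ((if Algebra.trace F K (Algebra.norm K b) = 0 then (Fintype.card F : ℂ) else 0) - 1) := by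
  have inner : ∀ t : F, t ≠ 0 →
      ∑ x : L, ψ (t * Algebra.trace F K (Algebra.norm K x) + Algebra.trace F L (b * x)) =
        -(Fintype.card K : ℂ) * ψ (t⁻¹ * -Algebra.trace F K (Algebra.norm K b)) := by
    intro t ht
    have := sum_addChar_mul_norm_add_trace h (hψ.compTrace (L := K))
      ((map_ne_zero (algebraMap F K)).2 ht) b
    simpa [← map_inv₀, ← Algebra.smul_def, Algebra.trace_trace] using this
  have zero : ∑ x : L, ψ (0 * Algebra.trace F K (Algebra.norm K x) +
      Algebra.trace F L (b * x)) = 0 := by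
    have := (hψ.compTrace (L := L)).sum_mul_eq_ite b
    simpa [hb, mul_comm b] using this
  calc
    _ = ∑ x : L, ∑ t : F,
        ψ (t * Algebra.trace F K (Algebra.norm K x) + Algebra.trace F L (b * x)) := by
      simp [AddChar.map_add_eq_mul, ← Finset.sum_mul, hψ.sum_mul_eq_ite, Finset.mul_sum,
        Finset.sum_filter, ite_mul]
    _ = ∑ t ∈ Finset.univ.erase (0 : F),
        -(Fintype.card K : ℂ) * ψ (t⁻¹ * -Algebra.trace F K (Algebra.norm K b)) := by
      rw [Finset.sum_comm, ← Finset.add_sum_erase _ _ (Finset.mem_univ 0), zero, zero_add]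
      exact Finset.sum_congr rfl fun t ht ↦ inner t (Finset.ne_of_mem_erase ht)
    _ = _ := by
      have := Equiv.sum_comp (Equiv.inv F)
        fun t ↦ ψ (t * -Algebra.trace F K (Algebra.norm K b))
      rw [hψ.sum_mul_eq_ite] at this
      simp only [Equiv.inv_apply, neg_eq_zero] at this
      rw [← Finset.mul_sum, Finset.sum_erase_eq_sub (Finset.mem_univ 0), this]
      simp

end FiniteField

/-- **Character values of the elliptic quadric.** Let `q` be an odd prime power. For every
nonzero `b ∈ F_{q^6}`, the canonical additive character sum over the nonzero singular
vectors of `Q(x) = Tr_{q^3/q}(x^{q^3+1})` equals `-q³ + q² - 1` if `Q(b) = 0` and `q² - 1`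
otherwise. -/
theorem elliptic_quadric_character_values
    (p n q : ℕ) (hp : p.Prime) (hn : 0 < n) (hqpn : q = p ^ n) (hqodd : Odd q)
    (L : Type) [Field L] [Fintype L] [Algebra (ZMod p) L]
    (hL : Fintype.card L = q ^ 6) :
    ∀ b : L, b ≠ 0 →
      (b ^ (q ^ 3 + 1) + b ^ ((q ^ 3 + 1) * q) + b ^ ((q ^ 3 + 1) * q ^ 2) = 0 →
        (∑ x ∈ Finset.univ.filter (fun x : L => x ≠ 0 ∧
            x ^ (q ^ 3 + 1) + x ^ ((q ^ 3 + 1) * q) + x ^ ((q ^ 3 + 1) * q ^ 2) = 0),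
          Complex.exp (2 * Real.pi * Complex.I *
            ((Algebra.trace (ZMod p) L (b * x)).val : ℂ) / p)) =
          -(q : ℂ) ^ 3 + (q : ℂ) ^ 2 - 1) ∧
      (b ^ (q ^ 3 + 1) + b ^ ((q ^ 3 + 1) * q) + b ^ ((q ^ 3 + 1) * q ^ 2) ≠ 0 →
        (∑ x ∈ Finset.univ.filter (fun x : L => x ≠ 0 ∧
            x ^ (q ^ 3 + 1) + x ^ ((q ^ 3 + 1) * q) + x ^ ((q ^ 3 + 1) * q ^ 2) = 0),
          Complex.exp (2 * Real.pi * Complex.I *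
            ((Algebra.trace (ZMod p) L (b * x)).val : ℂ) / p)) =
          (q : ℂ) ^ 2 - 1) := by
  have := Fact.mk hp
  let F := GaloisField p n
  let K := GaloisField p (n * 3)
  have := Fintype.ofFinite F
  have := Fintype.ofFinite K
  have hF : Fintype.card F = q := by
    rw [Fintype.card_eq_nat_card, GaloisField.card p n hn.ne', hqpn]
  have hK : Fintype.card K = q ^ 3 := by
    rw [Fintype.card_eq_nat_card, GaloisField.card p _ (by positivity), hqpn, pow_mul]
  obtain ⟨f⟩ := FiniteField.nonempty_algHom_of_card_eq_pow (K := F) (L := K) (p := p) (m := n)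
    (r := 3) (by rw [hK, hqpn, pow_mul]) (by rw [hF, hqpn])
  obtain ⟨g⟩ := FiniteField.nonempty_algHom_of_card_eq_pow (K := K) (L := L) (p := p)
    (m := n * 3) (r := 2) (by rw [hL, hqpn]; ring) (by rw [hK, hqpn, pow_mul])
  algebraize [f.toRingHom, g.toRingHom, g.toRingHom.comp f.toRingHom]
  have : IsScalarTower (ZMod p) F L := .of_algebraMap_eq' (Subsingleton.elim _ _)
  have hq1 : 1 < q := hF ▸ Fintype.one_lt_card
  have hq0 : (q : ℂ) ≠ 0 := by exact_mod_cast (zero_lt_one.trans hq1).ne'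
  have hKL : Module.finrank K L = 2 := by
    have h := Module.card_eq_pow_finrank (K := K) (V := L)
    rw [hL, hK, ← pow_mul] at h
    have := Nat.pow_right_injective hq1 h
    omega
  have hFK : Module.finrank F K = 3 := by
    have h := Module.card_eq_pow_finrank (K := F) (V := K)
    rw [hF, hK] at h
    exact (Nat.pow_right_injective hq1 h).symm
  have hQ (x : L) : x ^ (q ^ 3 + 1) + x ^ ((q ^ 3 + 1) * q) + x ^ ((q ^ 3 + 1) * q ^ 2) = 0 ↔
      Algebra.trace F K (Algebra.norm K x) = 0 := by
    rw [← map_eq_zero (algebraMap F K), ← map_eq_zero (algebraMap K L),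
      FiniteField.algebraMap_trace_eq_sum_pow, hFK, Nat.card_eq_fintype_card, hF]
    simp only [Finset.sum_range_succ, Finset.sum_range_zero, zero_add, map_add, map_pow,
      FiniteField.algebraMap_norm_eq_mul_pow_card hKL, hK, ← pow_succ', ← pow_mul, pow_zero,
      pow_one]
  have hψ (y : L) : Complex.exp (2 * Real.pi * Complex.I *
      ((Algebra.trace (ZMod p) L y).val : ℂ) / p) =
      (ZMod.stdAddChar (N := p)).compTrace F (Algebra.trace F L y) := by
    rw [AddChar.compTrace_apply, Algebra.trace_trace]
    simpa using (ZMod.stdAddChar_coe (N := p) (Algebra.trace (ZMod p) L y).val).symm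
  intro b hb
  have key := FiniteField.card_mul_sum_trace_norm_eq_zero hKL
    ((ZMod.isPrimitive_stdAddChar p).compTrace (L := F)) hb
  have hS : Finset.univ.filter (fun x : L => ¬x = 0 ∧ Algebra.trace F K (Algebra.norm K x) = 0) =
      (Finset.univ.filter fun x : L => Algebra.trace F K (Algebra.norm K x) = 0).erase 0 := by
    ext x
    simp
  simp only [ne_eq, hQ, hS, hψ]
  rw [Finset.sum_erase_eq_sub (by simp), mul_zero, map_zero, AddChar.map_zero_eq_one]
  rw [hF, hK] at key
  refine ⟨fun h ↦ ?_, fun h ↦ ?_⟩ <;> refine mul_left_cancel₀ hq0 ?_ <;>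
    simp only [h, if_true, if_false, Nat.cast_pow] at key <;> linear_combination key
end

section
/- Let q be a prime power, m ≥ 2 an integer, χ a nontrivial multiplicative character of F_{q^m}, and χ' the restriction of χ to F_q^×. Then Σ χ(x), where the sum is over all x ∈ F_{q^m} with Tr_{q^m/q}(x) = 1, equals G_{F_{q^m}}(χ)/G_{F_q}(χ') if χ' is nontrivial, and equals -G_{F_{q^m}}(χ)/q if χ' is trivial. -/
open scoped Classical

/-- Summing `χ x * g (Tr x)` over a field extension reduces to a sum over the base field, by
the homogeneity of the trace. -/
theorem MulChar.sum_mul_comp_trace {K E R : Type*} [Field K] [Fintype K] [Field E] [Fintype E]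
    [Algebra K E] [CommRing R] (χ : MulChar E R) (χ' : MulChar K R)
    (hres : ∀ x : K, χ' x = χ (algebraMap K E x)) (g : K → R) :
    ∑ x, χ x * g (Algebra.trace K E x) =
      (∑ x ∈ Finset.univ.filter (fun x : E => Algebra.trace K E x = 0), χ x) * g 0 +
      (∑ x ∈ Finset.univ.filter (fun x : E => Algebra.trace K E x = 1), χ x) *
        ∑ c, χ' c * g c := by
  have fiber (c : K) (hc : c ≠ 0) :
      ∑ x ∈ Finset.univ.filter (fun x : E => Algebra.trace K E x = c), χ x =
        χ' c * ∑ x ∈ Finset.univ.filter (fun x : E => Algebra.trace K E x = 1), χ x := by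
    rw [Finset.mul_sum]
    refine Finset.sum_bij' (fun x _ => c⁻¹ • x) (fun x _ => c • x) ?_ ?_ ?_ ?_ ?_
    · intro x hx
      simp_all
    · intro x hx
      simp_all
    · intro x _
      exact smul_inv_smul₀ hc x
    · intro x _
      exact inv_smul_smul₀ hc x
    · intro x _
      rw [hres, ← map_mul, ← Algebra.smul_def, smul_inv_smul₀ hc]
  rw [← Finset.sum_fiberwise Finset.univ (fun x : E => Algebra.trace K E x)]
  have collect (c : K) :
      ∑ x ∈ Finset.univ.filter (fun x : E => Algebra.trace K E x = c),
        χ x * g (Algebra.trace K E x) =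
      (∑ x ∈ Finset.univ.filter (fun x : E => Algebra.trace K E x = c), χ x) * g c := by
    rw [Finset.sum_mul]
    refine Finset.sum_congr rfl fun x hx => ?_
    rw [(Finset.mem_filter.mp hx).2]
  simp_rw [collect]
  rw [← Finset.add_sum_erase _ _ (Finset.mem_univ (0 : K)),
    ← Finset.add_sum_erase Finset.univ (fun c => χ' c * g c) (Finset.mem_univ (0 : K)),
    MulChar.map_zero, zero_mul, zero_add, Finset.mul_sum]
  congr 1
  refine Finset.sum_congr rfl fun c hc => ?_
  rw [fiber c (Finset.ne_of_mem_erase hc)]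
  ring

/-- The Gauss sum of `χ` over `E` in terms of data over `K` and the sum of `χ` over the elements
of trace one. -/
theorem gaussSum_comp_trace {K E R : Type*} [Field K] [Fintype K] [Field E] [Fintype E]
    [Algebra K E] [CommRing R] [IsDomain R] (χ : MulChar E R) (hχ : χ ≠ 1) (χ' : MulChar K R)
    (hres : ∀ x : K, χ' x = χ (algebraMap K E x)) (ψK : AddChar K R) (ψE : AddChar E R)
    (hψ : ∀ x, ψE x = ψK (Algebra.trace K E x)) :
    gaussSum χ ψE =
      (∑ x ∈ Finset.univ.filter (fun x : E => Algebra.trace K E x = 1), χ x) *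
        (gaussSum χ' ψK - ∑ c, χ' c) := by
  have hG := MulChar.sum_mul_comp_trace χ χ' hres ψK
  have h0 := MulChar.sum_mul_comp_trace χ χ' hres 1
  simp only [Pi.one_apply, mul_one, MulChar.sum_eq_zero_of_ne_one hχ] at h0
  rw [AddChar.map_zero_eq_one] at hG
  simp only [gaussSum, hψ]
  linear_combination hG - h0

/-- **Theorem 2.3 (Yamamoto).** Let `χ` be a nontrivial multiplicative character of `F_{q^m}`
with restriction `χ'` to `F_q^×`. Then `Σ_{Tr_{q^m/q}(x)=1} χ(x)` equals
`G_{q^m}(χ)/G_q(χ')` if `χ'` is nontrivial, and `-G_{q^m}(χ)/q` if `χ'` is trivial. -/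
theorem yamamoto_trace_one_sum
    (p f q m : ℕ) (hp : p.Prime) (hf : 0 < f) (hqpf : q = p ^ f) (hm : 2 ≤ m)
    (K E : Type) [Field K] [Fintype K] [Field E] [Fintype E] [Algebra K E]
    [Algebra (ZMod p) K] [Algebra (ZMod p) E]
    (hK : Fintype.card K = q) (hE : Fintype.card E = q ^ m)
    (χ : MulChar E ℂ) (hχ : χ ≠ 1)
    (χ' : MulChar K ℂ) (hres : ∀ x : K, χ' x = χ (algebraMap K E x))
    (ψK : AddChar K ℂ) (hψK : ∀ x : K, ψK x = Complex.exp (2 * Real.pi * Complex.I *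
      ((Algebra.trace (ZMod p) K x).val : ℂ) / p))
    (ψE : AddChar E ℂ) (hψE : ∀ x : E, ψE x = Complex.exp (2 * Real.pi * Complex.I *
      ((Algebra.trace (ZMod p) E x).val : ℂ) / p)) :
    (χ' ≠ 1 →
      (∑ x ∈ Finset.univ.filter (fun x : E => Algebra.trace K E x = 1), χ x) =
        gaussSum χ ψE / gaussSum χ' ψK) ∧
    (χ' = 1 →
      (∑ x ∈ Finset.univ.filter (fun x : E => Algebra.trace K E x = 1), χ x) =
        -gaussSum χ ψE / q) := by
  have : Fact p.Prime := ⟨hp⟩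
  have : IsScalarTower (ZMod p) K E := .of_algebraMap_eq' (Subsingleton.elim _ _)
  have hψ (x : E) : ψE x = ψK (Algebra.trace K E x) := by
    rw [hψE, hψK, Algebra.trace_trace]
  have hψ_one : ψK ≠ 1 := by
    intro h
    obtain ⟨x, hx⟩ := Algebra.trace_surjective (ZMod p) K 1
    have hexp := hψK x
    rw [h, AddChar.one_apply, hx, ZMod.val_one, Nat.cast_one, mul_one] at hexp
    exact (Complex.isPrimitiveRoot_exp p hp.ne_zero).ne_one hp.one_lt hexp.symm
  have hG := gaussSum_comp_trace χ hχ χ' hres ψK ψE hψ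
  refine ⟨fun hχ' => ?_, fun hχ' => ?_⟩
  · have hne : gaussSum χ' ψK ≠ 0 :=
      gaussSum_ne_zero_of_nontrivial (Nat.cast_ne_zero.mpr Fintype.card_ne_zero) hχ'
        (AddChar.IsPrimitive.of_ne_one hψ_one)
    rw [MulChar.sum_eq_zero_of_ne_one hχ', sub_zero] at hG
    rw [hG, mul_div_cancel_right₀ _ hne]
  · have hq : (q : ℂ) ≠ 0 := by
      rw [← hK]
      exact Nat.cast_ne_zero.mpr Fintype.card_ne_zero
    have hsum : ∑ c : K, (1 : MulChar K ℂ) c = q - 1 := by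
      rw [MulChar.sum_one_eq_card_units, Fintype.card_units, hK, Nat.cast_sub, Nat.cast_one]
      exact hqpf ▸ Nat.one_le_pow _ _ hp.pos
    rw [hχ', gaussSum_one_left hψ_one, hsum] at hG
    rw [eq_div_iff hq, hG]
    ring
end

section
/- Let p be a prime and m > 2 an integer such that p is semi-primitive modulo m, i.e. there exists a positive integer s with p^s ≡ -1 (mod m); choose s minimal with this property and let f = 2st for a positive integer t. Let χ_m be a multiplicative character of F_{p^f} of order m. Then G_{F_{p^f}}(χ_m) = (-1)^{t-1}·p^{f/2} if p = 2, and G_{F_{p^f}}(χ_m) = (-1)^{t-1+(p^s+1)t/m}·p^{f/2} if p > 2. -/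
open scoped Classical

section SemiprimitiveGaussSum

open Finset

variable {F : Type*} [Field F] [Fintype F]

/-- In a finite field, an element killed by the complementary exponent is an `n`-th power. -/
lemma FiniteField.exists_pow_eq_of_pow_eq_one {n k : ℕ} (hn : Fintype.card Fˣ = n * k) {w : Fˣ}
    (hw : w ^ k = 1) : ∃ y : Fˣ, y ^ n = w := by
  obtain ⟨g, hg⟩ := IsCyclic.exists_generator (α := Fˣ)
  obtain ⟨j, rfl⟩ := (mem_powers_iff_mem_zpowers (x := g)).2 (hg w)
  have hk : 0 < k := Nat.pos_of_mul_pos_left (hn ▸ Fintype.card_pos)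
  have hd : n * k ∣ j * k := by
    rw [← hn, ← orderOf_eq_card_of_forall_mem_zpowers hg |>.trans Nat.card_eq_fintype_card,
      orderOf_dvd_iff_pow_eq_one, pow_mul]
    exact hw
  obtain ⟨i, rfl⟩ := Nat.dvd_of_mul_dvd_mul_right hk hd
  exact ⟨g ^ i, by simp only [← pow_mul, mul_comm]⟩

lemma FiniteField.card_pow_eq_one {n : ℕ} (hn : n ∣ Fintype.card Fˣ) :
    #{y : Fˣ | y ^ n = 1} = n := by
  have h := IsCyclic.card_powMonoidHom_ker (G := Fˣ) n
  rw [Nat.card_eq_fintype_card (α := Fˣ), Nat.gcd_eq_right hn] at h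
  refine Eq.trans ?_ h
  rw [Nat.card_eq_fintype_card, Fintype.card_subtype]
  congr 1
  ext; simp

lemma FiniteField.sum_units_comp_pow {n : ℕ} (hn : n ∣ Fintype.card Fˣ) (f : Fˣ → ℂ) :
    ∑ x : Fˣ, f (x ^ n) = n * ∑ y ∈ univ.image (fun x : Fˣ ↦ x ^ n), f y := by
  rw [← sum_fiberwise_of_maps_to (g := fun x : Fˣ ↦ x ^ n) (t := univ.image (fun x : Fˣ ↦ x ^ n))
    (fun x _ ↦ mem_image_of_mem _ (mem_univ x)), mul_sum]
  refine sum_congr rfl fun y hy ↦ ?_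
  rw [sum_congr rfl (g := fun _ ↦ f y) (fun x hx ↦ by rw [(mem_filter.1 hx).2]), sum_const,
    nsmul_eq_mul]
  congr 2
  refine Eq.trans ?_ (FiniteField.card_pow_eq_one hn)
  obtain ⟨z, -, rfl⟩ := mem_image.1 hy
  exact MonoidHom.card_fiber_eq_of_mem_range (powMonoidHom n : Fˣ →* Fˣ) ⟨z, rfl⟩ ⟨1, by simp⟩

lemma Fintype.sum_eq_zero_add_sum_units (f : F → ℂ) : ∑ x, f x = f 0 + ∑ x : Fˣ, f x := by
  rw [← add_sum_erase _ _ (mem_univ (0 : F))]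
  congr 1
  refine (sum_bij (fun (x : Fˣ) _ ↦ (x : F)) (by simp) (fun _ _ _ _ h ↦ Units.ext h)
    (fun b hb ↦ ⟨Units.mk0 b (mem_erase.1 hb).1, mem_univ _, rfl⟩) fun _ _ ↦ rfl).symm

lemma AddChar.isIntegral_apply (ψ : AddChar F ℂ) (x : F) : IsIntegral ℤ (ψ x) := by
  refine IsIntegral.of_pow (n := Fintype.card F) Fintype.card_pos ?_
  rw [← AddChar.map_nsmul_eq_pow, card_nsmul_eq_zero, AddChar.map_zero_eq_one]
  exact isIntegral_one

/-- The sum of an additive character over the values `a x ^ n`. -/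
noncomputable def monomialSum (ψ : AddChar F ℂ) (n : ℕ) (a : F) : ℂ := ∑ x, ψ (a * x ^ n)

/-- A sum of an additive character over `n`-th powers is congruent to `1` modulo `n`. -/
lemma exists_isIntegral_monomialSum_eq (ψ : AddChar F ℂ) {n : ℕ} (hn : n ∣ Fintype.card Fˣ)
    (a : F) :
    ∃ T : ℂ, IsIntegral ℤ T ∧ monomialSum ψ n a = 1 + n * T := by
  have hn0 : n ≠ 0 := fun h ↦ Fintype.card_ne_zero (zero_dvd_iff.1 (h ▸ hn))
  refine ⟨∑ y ∈ univ.image (fun x : Fˣ ↦ x ^ n), ψ (a * y),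
    IsIntegral.sum _ fun y _ ↦ ψ.isIntegral_apply _, ?_⟩
  rw [← FiniteField.sum_units_comp_pow hn fun y ↦ ψ (a * y), monomialSum,
    Fintype.sum_eq_zero_add_sum_units]
  simp [hn0]

lemma int_dvd_of_isIntegral {z n : ℤ} {T : ℂ} (hT : IsIntegral ℤ T) (h : (z : ℂ) = n * T) :
    n ∣ z := by
  rcases eq_or_ne n 0 with rfl | hn
  · simp_all
  have hn' : (n : ℂ) ≠ 0 := by exact_mod_cast hn
  obtain ⟨k, rfl⟩ := hT.exists_int_iff_exists_rat.1 ⟨(z : ℚ) / n, by push_cast; rw [h]; field_simp⟩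
  exact ⟨k, by exact_mod_cast h⟩

/-- Summing monomial sums against a multiplicative character recovers the Gauss sum. -/
lemma sum_mulChar_mul_monomialSum (χ : MulChar F ℂ) (ψ : AddChar F ℂ) {n : ℕ} (hn : n ≠ 0)
    (hχ : χ ^ n = 1) :
    ∑ a, χ a * monomialSum ψ n a = ∑ a, χ a + Fintype.card Fˣ * gaussSum χ ψ := by
  simp only [monomialSum, mul_sum]
  rw [sum_comm, Fintype.sum_eq_zero_add_sum_units]
  congr 1
  · simp [hn]
  · rw [sum_congr rfl (g := fun _ ↦ gaussSum χ ψ), sum_const, card_univ, nsmul_eq_mul]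
    intro x _
    have h := gaussSum_mulShift χ ψ (x ^ n)
    rw [Units.val_pow_eq_pow_val, map_pow, ← MulChar.pow_apply' _ hn, hχ, MulChar.one_apply_coe,
      one_mul] at h
    rw [← h]
    simp only [gaussSum, AddChar.mulShift_apply, mul_comm (x ^ n : F)]

section Hermitian

variable {ψ : AddChar F ℂ} {q t : ℕ}

/-- Evaluation of the product of two opposite sums of Hermitian type. -/
lemma monomialSum_mul_monomialSum_neg (hψ : ψ.IsPrimitive)
    (hadd : ∀ x y : F, (x + y) ^ q = x ^ q + y ^ q) (hψq : ∀ x, ψ (x ^ q) = ψ x)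
    (hq : q ≠ 0) (a : F) :
    monomialSum ψ (q + 1) a * monomialSum ψ (q + 1) (-a) =
      Fintype.card F * ∑ x with a ^ q * x ^ q ^ 2 + a * x = 0, ψ (a * x ^ (q + 1)) := by
  have hbij : Function.Bijective fun y : F ↦ y ^ q := by
    refine Finite.injective_iff_bijective.1 fun x y h ↦ ?_
    have h1 := hadd (x - y) y
    simp only [sub_add_cancel] at h1
    rw [show x ^ q = y ^ q from h, right_eq_add, pow_eq_zero_iff hq, sub_eq_zero] at h1
    exact h1
  calc
    _ = ∑ y, ∑ x, ψ (a * (x + y) ^ (q + 1)) * ψ (-a * y ^ (q + 1)) := by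
      simp only [monomialSum, mul_sum, sum_mul]
      refine sum_congr rfl fun y _ ↦ ?_
      exact (Equiv.sum_comp (Equiv.addRight y)
        fun x ↦ ψ (a * x ^ (q + 1)) * ψ (-a * y ^ (q + 1))).symm
    _ = ∑ x, ψ (a * x ^ (q + 1)) * ∑ y, ψ (y ^ q * (a ^ q * x ^ q ^ 2 + a * x)) := by
      rw [sum_comm]
      refine sum_congr rfl fun x _ ↦ ?_
      rw [mul_sum]
      refine sum_congr rfl fun y _ ↦ ?_
      have h := hψq (a * x ^ q * y)
      have e : a * (x + y) ^ (q + 1) + -a * y ^ (q + 1) =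
          a * x ^ (q + 1) + (a * x ^ q * y + a * x * y ^ q) := by
        rw [pow_succ, hadd]; ring
      rw [← AddChar.map_add_eq_mul, e, AddChar.map_add_eq_mul,
        AddChar.map_add_eq_mul _ (a * x ^ q * y), ← h, ← AddChar.map_add_eq_mul]
      congr 2
      ring
    _ = _ := by
      rw [sum_filter, mul_sum]
      refine sum_congr rfl fun x _ ↦ ?_
      rw [hbij.sum_comp fun z ↦ ψ (z * (a ^ q * x ^ q ^ 2 + a * x)),
        AddChar.sum_mulShift _ hψ]
      split_ifs <;> simp [mul_comm]

/-- The solution set of the additive equation has `q ^ 2` elements once it is nontrivial. -/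
lemma card_solutions (hd : q ^ 2 - 1 ∣ Fintype.card Fˣ) (hq : q ≠ 0) {a x₀ : F} (ha : a ≠ 0)
    (hx₀ : x₀ ≠ 0) (h₀ : a ^ q * x₀ ^ q ^ 2 + a * x₀ = 0) :
    #{x : F | a ^ q * x ^ q ^ 2 + a * x = 0} = q ^ 2 := by
  have hq2 : q ^ 2 = q ^ 2 - 1 + 1 := (Nat.sub_add_cancel (Nat.pos_of_ne_zero (by positivity))).symm
  have : ({x : F | a ^ q * x ^ q ^ 2 + a * x = 0} : Finset F) =
      insert 0 (({y : Fˣ | y ^ (q ^ 2 - 1) = 1} : Finset Fˣ).image fun y : Fˣ ↦ x₀ * (y : F)) := by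
    ext x
    simp only [mem_filter, mem_univ, true_and, mem_insert, mem_image]
    constructor
    · intro h
      refine or_iff_not_imp_left.2 fun hx ↦ ⟨Units.mk0 (x / x₀) (div_ne_zero hx hx₀), ?_, ?_⟩
      · rw [Units.ext_iff]
        have h1 : (x / x₀) ^ q ^ 2 = x / x₀ := by
          have h2 : x ^ q ^ 2 * x₀ = x * x₀ ^ q ^ 2 := by
            refine mul_left_cancel₀ (pow_ne_zero q ha) ?_
            linear_combination x₀ * h - x * h₀
          rw [div_pow, div_eq_div_iff (pow_ne_zero _ hx₀) hx₀, h2]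
        rw [hq2, pow_succ] at h1
        simpa using mul_right_cancel₀ (div_ne_zero hx hx₀) (h1.trans (one_mul _).symm)
      · simp [mul_div_cancel₀ _ hx₀]
    · rintro (rfl | ⟨y, hy, rfl⟩)
      · simp [hq]
      · have : (y : F) ^ q ^ 2 = y := by
          rw [hq2, pow_succ, ← Units.val_pow_eq_pow_val, hy]; simp
        rw [mul_pow, this]
        linear_combination (y : F) * h₀
  rw [this, card_insert_of_notMem (by simp [hx₀]), card_image_of_injective,
    FiniteField.card_pow_eq_one hd, ← hq2]
  exact fun y z h ↦ Units.ext (mul_left_cancel₀ hx₀ h)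

/-- A complex number congruent to `1` modulo `q + 1` whose square is `q ^ (2 * e)` equals
`(-q) ^ e`. -/
lemma eq_neg_one_pow_mul_pow_of_sq_eq (hq : 2 ≤ q) {e : ℕ} {S T : ℂ} (hT : IsIntegral ℤ T)
    (hS : S = 1 + (q + 1 : ℕ) * T) (hS2 : S ^ 2 = ((q : ℂ) ^ e) ^ 2) :
    S = (-1) ^ e * (q : ℂ) ^ e := by
  have key : ∀ ε : ℤ, ((q : ℤ) + 1) ∣ ε * q ^ e - 1 → ((q : ℤ) + 1) ∣ ε * (-1) ^ e - 1 := by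
    intro ε h
    have h1 : ((q : ℤ) + 1) ∣ q ^ e - (-1) ^ e := by
      simpa using sub_dvd_pow_sub_pow (q : ℤ) (-1) e
    have := dvd_sub h (h1.mul_left ε)
    ring_nf at this ⊢
    exact this
  have not_dvd : ¬ ((q : ℤ) + 1) ∣ -2 := fun h ↦ by
    have := Int.le_of_dvd (by norm_num) (Int.dvd_neg.2 h)
    omega
  rcases sq_eq_sq_iff_eq_or_eq_neg.1 hS2 with h | h <;>
    rcases Nat.even_or_odd e with he | he
  · simp [h, he.neg_one_pow]
  · refine absurd (key 1 (int_dvd_of_isIntegral hT ?_)) ?_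
    · push_cast; rw [one_mul, ← h, hS]; push_cast; ring
    · simpa [he.neg_one_pow] using not_dvd
  · refine absurd (key (-1) (int_dvd_of_isIntegral hT ?_)) ?_
    · push_cast; rw [neg_one_mul, ← h, hS]; push_cast; ring
    · simpa [he.neg_one_pow] using not_dvd
  · simp [h, he.neg_one_pow]

/-- The value of a sum of Hermitian type. -/
lemma monomialSum_eq (hψ : ψ.IsPrimitive)
    (hadd : ∀ x y : F, (x + y) ^ q = x ^ q + y ^ q) (hψq : ∀ x, ψ (x ^ q) = ψ x)
    (hker : ∀ u, u ^ q = -u → ψ u = 1) (hneg : ∃ y : F, y ^ (q + 1) = -1)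
    (hq : 2 ≤ q) (hF : Fintype.card F = q ^ (2 * t)) (hd : q ^ 2 - 1 ∣ Fintype.card Fˣ)
    {a : F} (ha : a ≠ 0) :
    monomialSum ψ (q + 1) a = (-1) ^ t * (q : ℂ) ^ t *
      (1 - if ∃ x ≠ 0, a ^ q * x ^ q ^ 2 + a * x = 0 then (q + 1 : ℂ) else 0) := by
  have hq0 : q ≠ 0 := by omega
  obtain ⟨T, hT, hS⟩ := exists_isIntegral_monomialSum_eq ψ
    ((Dvd.intro _ (Nat.sq_sub_sq q 1).symm).trans hd) a
  have hreal : monomialSum ψ (q + 1) (-a) = monomialSum ψ (q + 1) a := by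
    obtain ⟨y, hy⟩ := hneg
    have hy0 : y ≠ 0 := by rintro rfl; simp at hy
    rw [monomialSum, ← Equiv.sum_comp (Equiv.mulLeft₀ y hy0)]
    simp [monomialSum, mul_pow, hy]
  have hsq : monomialSum ψ (q + 1) a ^ 2 =
      q ^ (2 * t) * #{x : F | a ^ q * x ^ q ^ 2 + a * x = 0} := by
    rw [sq]
    nth_rewrite 2 [← hreal]
    rw [monomialSum_mul_monomialSum_neg hψ hadd hψq hq0, hF, sum_congr rfl (g := fun _ ↦ 1)]
    · simp
    · intro x hx
      refine hker _ ?_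
      linear_combination x ^ q * (mem_filter.1 hx).2
  split_ifs with h
  · obtain ⟨x, hx, hx0⟩ := h
    rw [card_solutions hd hq0 ha hx hx0] at hsq
    rw [eq_neg_one_pow_mul_pow_of_sq_eq hq hT hS (e := t + 1) (by rw [hsq]; push_cast; ring)]
    ring
  · have : #{x : F | a ^ q * x ^ q ^ 2 + a * x = 0} = 1 := by
      rw [card_eq_one]
      refine ⟨0, ?_⟩
      ext x
      simp only [mem_filter, mem_univ, true_and, mem_singleton]
      refine ⟨fun hx ↦ by_contra fun h0 ↦ h ⟨x, h0, hx⟩, ?_⟩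
      rintro rfl
      simp [hq0]
    rw [this] at hsq
    rw [eq_neg_one_pow_mul_pow_of_sq_eq hq hT hS (e := t) (by rw [hsq]; push_cast; ring)]
    ring

/-- A Gauss sum of a character of order dividing `q + 1` over a field with `q ^ (2 * t)` elements,
in terms of the constant value of the character on the solutions of `u ^ q = -u`. -/
lemma gaussSum_eq_of_pow_eq_one (hψ : ψ.IsPrimitive)
    (hadd : ∀ x y : F, (x + y) ^ q = x ^ q + y ^ q) (hψq : ∀ x, ψ (x ^ q) = ψ x)
    (hker : ∀ u, u ^ q = -u → ψ u = 1) (hneg : ∃ y : F, y ^ (q + 1) = -1)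
    (hq : 2 ≤ q) (hF : Fintype.card F = q ^ (2 * t)) (hd : q ^ 2 - 1 ∣ Fintype.card Fˣ)
    {χ : MulChar F ℂ} (hχ1 : χ ≠ 1) (hχ : χ ^ (q + 1) = 1) {ε : ℂ}
    (hε : ∀ u, u ≠ 0 → u ^ q = -u → χ u = ε) :
    gaussSum χ ψ = -(-1) ^ t * (q : ℂ) ^ t * ε := by
  set A : Finset F := {a | a ≠ 0 ∧ ∃ x ≠ 0, a ^ q * x ^ q ^ 2 + a * x = 0} with hA
  have hsum (φ : MulChar F ℂ) : ∑ a, φ a * monomialSum ψ (q + 1) a =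
      (-1) ^ t * (q : ℂ) ^ t * (∑ a, φ a - (q + 1) * ∑ a ∈ A, φ a) := by
    rw [hA, sum_filter, mul_sum, ← sum_sub_distrib, mul_sum]
    refine sum_congr rfl fun a _ ↦ ?_
    by_cases ha : a = 0
    · simp [ha, MulChar.map_zero]
    · rw [monomialSum_eq hψ hadd hψq hker hneg hq hF hd ha]
      simp only [ne_eq, ha, not_false_eq_true, true_and]
      split_ifs <;> ring
  have hχA : ∑ a ∈ A, χ a = #A * ε := by
    rw [sum_congr rfl (g := fun _ ↦ ε), sum_const, nsmul_eq_mul]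
    intro a ha
    obtain ⟨ha, x, hx, h⟩ := (mem_filter.1 ha).2
    rw [← hε (a * x ^ (q + 1)) (mul_ne_zero ha (pow_ne_zero _ hx))
      (by linear_combination x ^ q * h), map_mul, map_pow, ← MulChar.pow_apply' _ (by omega), hχ,
      MulChar.one_apply hx.isUnit, mul_one]
  have h1A : ∑ a ∈ A, (1 : MulChar F ℂ) a = #A := by
    rw [sum_congr rfl (g := fun _ ↦ 1) fun a ha ↦
      MulChar.one_apply (mem_filter.1 ha).2.1.isUnit]
    simp
  have hψ1 : ψ ≠ 1 := by simpa using hψ one_ne_zero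
  have h1 := sum_mulChar_mul_monomialSum 1 ψ q.succ_ne_zero (one_pow _)
  rw [Nat.succ_eq_add_one, hsum, gaussSum_one_left hψ1, MulChar.sum_one_eq_card_units, h1A,
    mul_neg_one, add_neg_cancel, mul_eq_zero, sub_eq_zero] at h1
  have hcard : (Fintype.card Fˣ : ℂ) = (q + 1) * #A := h1.resolve_left (by
    simp; omega)
  have h2 := sum_mulChar_mul_monomialSum χ ψ q.succ_ne_zero hχ
  rw [Nat.succ_eq_add_one, hsum, MulChar.sum_eq_zero_of_ne_one hχ1, hχA] at h2
  refine mul_left_cancel₀ (Nat.cast_ne_zero.2 (Fintype.card_ne_zero (α := Fˣ))) ?_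
  linear_combination -h2 + (-1) ^ t * (q : ℂ) ^ t * ε * hcard

end Hermitian

lemma exists_pow_two_mul_eq (r t : ℕ) :
    ∃ M, (r + 1) ^ (2 * t) = r * (r + 2) * M + 1 ∧ (Even r → (Even M ↔ Even t)) := by
  induction t with
  | zero => exact ⟨0, by simp⟩
  | succ t ih =>
    obtain ⟨M, h, hM⟩ := ih
    refine ⟨(r + 1) ^ 2 * M + 1, ?_, fun hr ↦ ?_⟩
    · rw [mul_add, pow_add, h]; ring
    · simp [Nat.even_add_one, Nat.even_mul, Nat.even_pow, hr, hM hr]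

/-- A character whose order divides `r + 2` is trivial on the elements with `u ^ r = 1`. -/
lemma MulChar.apply_of_pow_eq_one {r M : ℕ} {χ : MulChar F ℂ} (hχ : χ ^ (r + 2) = 1)
    (hM : Fintype.card Fˣ = r * (r + 2) * M) {u : Fˣ} (hu : u ^ r = 1) : χ u = 1 := by
  obtain ⟨y, rfl⟩ := FiniteField.exists_pow_eq_of_pow_eq_one (n := (r + 2) * M) (k := r)
    (by rw [hM]; ring) hu
  rw [pow_mul, Units.val_pow_eq_pow_val, Units.val_pow_eq_pow_val, map_pow, map_pow,
    ← MulChar.pow_apply_coe, hχ, MulChar.one_apply_coe, one_pow]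

/-- The value of a character of order `m` on the elements with `u ^ r = -1`. -/
lemma MulChar.apply_of_pow_eq_neg_one {r m n t M : ℕ} {χ : MulChar F ℂ} (hχ : orderOf χ = m)
    (hmn : r + 2 = m * n) (hM : Fintype.card Fˣ = r * (r + 2) * M)
    (hMt : Even M ↔ Even t) (hr : Even r) (h1 : (-1 : Fˣ) ≠ 1)
    {u : Fˣ} (hu : u ^ r = -1) : χ u = (-1) ^ (n * t) := by
  obtain ⟨g, hg⟩ := IsCyclic.exists_generator (α := Fˣ)
  obtain ⟨k, rfl⟩ := (mem_powers_iff_mem_zpowers (x := g)).2 (hg u)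
  have hord : orderOf g = r * (r + 2) * M := by
    rw [orderOf_eq_card_of_forall_mem_zpowers hg, Nat.card_eq_fintype_card, hM]
  have hpos : 0 < r * (r + 2) * M := hM ▸ Fintype.card_pos
  have hr0 : 0 < r := Nat.pos_of_mul_pos_right (Nat.pos_of_mul_pos_right hpos)
  have hζ : χ g ^ m = 1 := by
    rw [← MulChar.pow_apply_coe, ← hχ, pow_orderOf_eq_one, MulChar.one_apply_coe]
  obtain ⟨j, hj⟩ : (r + 2) * M ∣ 2 * k := by
    refine Nat.dvd_of_mul_dvd_mul_left hr0 ?_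
    rw [← mul_assoc, ← hord, orderOf_dvd_iff_pow_eq_one, show r * (2 * k) = k * r * 2 by ring,
      pow_mul, pow_mul, hu]
    simp
  have hj_odd : ¬ Even j := by
    rintro ⟨i, rfl⟩
    refine h1 (hu ▸ ?_)
    change (g ^ k) ^ r = 1
    rw [← pow_mul, ← orderOf_dvd_iff_pow_eq_one, hord]
    exact ⟨i, by rw [show k = (r + 2) * M * i by linarith]; ring⟩
  rw [Units.val_pow_eq_pow_val, map_pow]
  rcases Nat.even_or_odd' m with ⟨m', rfl | hm⟩
  · have hk : k = m' * (n * M * j) := by rw [hmn] at hj; linarith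
    have hm'0 : 0 < m' := by
      rcases Nat.eq_zero_or_pos m' with rfl | h
      · simp at hmn
      · exact h
    have hne : χ g ^ m' ≠ 1 := by
      rw [← MulChar.pow_apply_coe, ← MulChar.one_apply_coe (R' := ℂ) g, Ne, ← MulChar.eq_iff hg]
      exact pow_ne_one_of_lt_orderOf hm'0.ne' (by omega)
    have hneg : χ g ^ m' = -1 := by
      rw [mul_comm, pow_mul] at hζ
      exact (sq_eq_one_iff.1 hζ).resolve_left hne
    rw [hk, pow_mul, hneg]
    refine neg_one_pow_congr ?_
    simp [Nat.even_mul, hMt, hj_odd]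
  · have hn : Even n := by
      have : Even (m * n) := hmn ▸ hr.add even_two
      exact (Nat.even_mul.1 this).resolve_left (by rw [Nat.not_even_iff_odd]; exact ⟨m', hm⟩)
    obtain ⟨n', rfl⟩ := hn
    rw [show k = m * (n' * M * j) by rw [hmn] at hj; linarith, pow_mul, hζ, one_pow,
      (Even.add_self n').mul_right t |>.neg_one_pow]

lemma trace_zmod_pow_char_pow {p : ℕ} [Fact p.Prime] [Algebra (ZMod p) F] (s : ℕ) (x : F) :
    Algebra.trace (ZMod p) F (x ^ p ^ s) = Algebra.trace (ZMod p) F x := by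
  induction s with
  | zero => simp
  | succ s ih =>
    have h := Algebra.trace_eq_of_algEquiv (FiniteField.frobeniusAlgEquivOfAlgebraic (ZMod p) F)
      (x ^ p ^ s)
    simp only [FiniteField.coe_frobeniusAlgEquivOfAlgebraic, ZMod.card, ← pow_mul, ← pow_succ] at h
    rw [h, ih]

/-- In characteristic two, the absolute trace vanishes on subfields of even index. -/
lemma trace_zmod_two_eq_zero [Algebra (ZMod 2) F] {s t : ℕ}
    (hF : Fintype.card F = 2 ^ (2 * s * t)) {u : F} (hu : u ^ 2 ^ s = u) :
    Algebra.trace (ZMod 2) F u = 0 := by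
  have := charP_of_injective_algebraMap (algebraMap (ZMod 2) F).injective 2
  have hfin : Module.finrank (ZMod 2) F = s * t + s * t := by
    have h := Module.card_eq_pow_finrank (K := ZMod 2) (V := F)
    rw [hF, ZMod.card] at h
    rw [← Nat.pow_right_injective le_rfl h]
    ring
  have hut : u ^ 2 ^ (s * t) = u := by
    clear hF hfin
    induction t with
    | zero => simp
    | succ t ih => rw [mul_add_one, pow_add, pow_mul, ih, hu]
  refine (algebraMap (ZMod 2) F).injective ?_
  rw [FiniteField.algebraMap_trace_eq_sum_pow, hfin, sum_range_add, Nat.card_zmod, map_zero]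
  simp only [pow_add, pow_mul _ (2 ^ (s * t)), hut]
  exact CharTwo.add_self_eq_zero _

end SemiprimitiveGaussSum

/-- **Theorem 2.4 (semi-primitive Gauss sums).** Let `p` be a prime, `m > 2`, and let `s` be
minimal with `p^s ≡ -1 (mod m)`; put `f = 2st`. If `χ_m` has order `m` on `F_{p^f}`, then
`G_{p^f}(χ_m) = (-1)^{t-1} p^{f/2}` if `p = 2`, and
`G_{p^f}(χ_m) = (-1)^{t-1+(p^s+1)t/m} p^{f/2}` if `p > 2`. -/
theorem semiprimitive_gauss_sum
    (p m s t : ℕ) (hp : p.Prime) (hm : 2 < m) (hs : 0 < s) (ht : 0 < t)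
    (hsemi : m ∣ p ^ s + 1) (hsmin : ∀ s' : ℕ, 0 < s' → m ∣ p ^ s' + 1 → s ≤ s')
    (F : Type) [Field F] [Fintype F] [Algebra (ZMod p) F]
    (hF : Fintype.card F = p ^ (2 * s * t))
    (χm : MulChar F ℂ) (hχm : orderOf χm = m)
    (ψF : AddChar F ℂ) (hψF : ∀ x : F, ψF x = Complex.exp (2 * Real.pi * Complex.I *
      ((Algebra.trace (ZMod p) F x).val : ℂ) / p)) :
    gaussSum χm ψF =
      (if p = 2 then (-1 : ℂ) ^ (t - 1) else (-1 : ℂ) ^ (t - 1 + (p ^ s + 1) * t / m)) *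
        (p : ℂ) ^ (s * t) := by
  have : Fact p.Prime := ⟨hp⟩
  have : CharP F p := charP_of_injective_algebraMap (algebraMap (ZMod p) F).injective p
  obtain ⟨r, hr⟩ : ∃ r, p ^ s = r + 1 := ⟨p ^ s - 1, (Nat.sub_add_cancel (Nat.pow_pos hp.pos)).symm⟩
  obtain ⟨n, hn⟩ := hsemi
  have hrmn : r + 2 = m * n := by omega
  obtain ⟨M, hM, hMt⟩ := exists_pow_two_mul_eq r t
  have hF' : Fintype.card F = (p ^ s) ^ (2 * t) := by rw [hF]; ring
  have hcard : Fintype.card Fˣ = r * (r + 2) * M := by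
    rw [Fintype.card_units, hF', hr, hM, Nat.add_sub_cancel]
  have hψ (x : F) : ψF x = ZMod.stdAddChar (Algebra.trace (ZMod p) F x) := by
    rw [hψF, ZMod.stdAddChar_apply, ZMod.toCircle_apply]
  have hprim : ψF.IsPrimitive := by
    refine AddChar.IsPrimitive.of_ne_one fun h ↦ ?_
    obtain ⟨x, hx⟩ := Algebra.trace_surjective (ZMod p) F 1
    have h1 := hψ x
    rw [h, AddChar.one_apply, hx, ← AddChar.map_zero_eq_one (ZMod.stdAddChar (N := p))] at h1
    exact zero_ne_one (ZMod.injective_stdAddChar h1)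
  have hψq (x : F) : ψF (x ^ p ^ s) = ψF x := by rw [hψ, hψ, trace_zmod_pow_char_pow]
  have hχ : χm ^ (p ^ s + 1) = 1 := by rw [hn, pow_mul, ← hχm, pow_orderOf_eq_one, one_pow]
  have hχ1 : χm ≠ 1 := by
    rintro rfl
    rw [orderOf_one] at hχm
    omega
  have hq : 2 ≤ p ^ s := hp.two_le.trans (Nat.le_self_pow hs.ne' p)
  have hd : (p ^ s) ^ 2 - 1 ∣ Fintype.card Fˣ :=
    ⟨M, by rw [hcard, hr, show (r + 1) ^ 2 = r * (r + 2) + 1 by ring, Nat.add_sub_cancel]⟩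
  have hadd (x y : F) : (x + y) ^ p ^ s = x ^ p ^ s + y ^ p ^ s := add_pow_char_pow x y p s
  have hur {u : F} (hu0 : u ≠ 0) (hu : u ^ p ^ s = -u) : (Units.mk0 u hu0) ^ r = -1 := by
    rw [hr, pow_succ] at hu
    ext
    refine mul_right_cancel₀ hu0 ?_
    simpa using hu
  have hsign : -(-1 : ℂ) ^ t = (-1) ^ (t - 1) := by
    obtain ⟨t, rfl⟩ := Nat.exists_eq_succ_of_ne_zero ht.ne'
    simp [pow_succ]
  rw [pow_mul]
  split_ifs with hp2
  · subst hp2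
    have hone : (-1 : Fˣ) = 1 := by
      ext
      simp [CharTwo.neg_eq]
    have hG := gaussSum_eq_of_pow_eq_one hprim hadd hψq (fun u hu ↦ by
        rw [hψ, trace_zmod_two_eq_zero hF (hu.trans (CharTwo.neg_eq u)), AddChar.map_zero_eq_one])
      ⟨1, by simp [CharTwo.neg_eq]⟩ hq hF' hd hχ1 hχ (ε := 1) fun u hu0 hu ↦
        MulChar.apply_of_pow_eq_one (u := Units.mk0 u hu0) (by rw [← hχ, hr]) hcard
          ((hur hu0 hu).trans hone)
    rw [hG, hsign]
    push_cast
    ring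
  · have hpodd : Odd p := hp.odd_of_ne_two hp2
    have hreven : Even r := by
      have := hpodd.pow (n := s)
      rw [hr] at this
      simpa [Nat.odd_add_one] using this
    have hone : (-1 : F) ≠ 1 := Ring.neg_one_ne_one_of_char_ne_two (by
      rwa [ringChar.eq F p])
    have hG := gaussSum_eq_of_pow_eq_one hprim hadd hψq (fun u hu ↦ by
        have h := trace_zmod_pow_char_pow (p := p) s u
        rw [hu, map_neg] at h
        rw [hψ, (Ring.eq_self_iff_eq_zero_of_char_ne_two (by rwa [ZMod.ringChar_zmod_n])).1 h,
          AddChar.map_zero_eq_one])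
      (by
        obtain ⟨y, hy⟩ := FiniteField.exists_pow_eq_of_pow_eq_one (F := F) (n := r + 2) (k := r * M)
          (by rw [hcard]; ring) (hreven.mul_right M).neg_one_pow
        exact ⟨y, by rw [hr, ← Units.val_pow_eq_pow_val, hy]; simp⟩)
      hq hF' hd hχ1 hχ (ε := (-1) ^ (n * t)) fun u hu0 hu ↦
        MulChar.apply_of_pow_eq_neg_one (u := Units.mk0 u hu0) hχm hrmn hcard (hMt hreven) hreven
          (fun h ↦ hone (by simpa using congrArg Units.val h)) (hur hu0 hu)
    rw [hG, hsign, hn, mul_assoc m, Nat.mul_div_cancel_left _ (by omega), pow_add]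
    push_cast
    ring
end

section
/- Let p be a prime, f and s positive integers with s ≥ 2, let χ' be a nontrivial multiplicative character of F_{p^f}, and let χ be the lift of χ' to F_{p^{fs}}, i.e. χ(α) = χ'(Norm_{p^{fs}/p^f}(α)) for α ∈ F_{p^{fs}}. Then G_{F_{p^{fs}}}(χ) = (-1)^{s-1}·(G_{F_{p^f}}(χ'))^s. -/
open scoped Classical
open Polynomial Finset

section MonicSums

variable (F : Type*) [Field F] [Finite F]

theorem finite_setOf_monic_natDegree_eq (n : ℕ) :
    {f : F[X] | f.Monic ∧ f.natDegree = n}.Finite := by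
  have : Finite (degreeLT F (n + 1)) := Module.finite_of_finite F
  refine (Set.toFinite (degreeLT F (n + 1) : Set F[X])).subset fun f hf => ?_
  rw [SetLike.mem_coe, mem_degreeLT, degree_eq_natDegree hf.1.ne_zero, hf.2]
  exact_mod_cast n.lt_succ_self

/-- The monic polynomials of degree `n` over a finite field. -/
noncomputable def monicsOfDegree (n : ℕ) : Finset F[X] :=
  (finite_setOf_monic_natDegree_eq F n).toFinset

/-- The monic irreducible polynomials of degree at most `N` over a finite field. -/
noncomputable def monicIrreducibles (N : ℕ) : Finset F[X] :=
  ((range (N + 1)).biUnion (monicsOfDegree F)).filter Irreducible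

variable {F}

@[simp]
theorem mem_monicsOfDegree {n : ℕ} {f : F[X]} :
    f ∈ monicsOfDegree F n ↔ f.Monic ∧ f.natDegree = n := by
  simp [monicsOfDegree]

@[simp]
theorem mem_monicIrreducibles {N : ℕ} {f : F[X]} :
    f ∈ monicIrreducibles F N ↔ f.Monic ∧ f.natDegree ≤ N ∧ Irreducible f := by
  simp [monicIrreducibles, and_assoc, and_left_comm]

theorem natDegree_eq_sum_pow_dvd {N : ℕ} {f : F[X]} (hf : f.Monic) (hN : f.natDegree ≤ N) :
    f.natDegree =
      ∑ P ∈ monicIrreducibles F N, ∑ j ∈ Icc 1 N, if P ^ j ∣ f then P.natDegree else 0 := by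
  have hmonic : ∀ P ∈ UniqueFactorizationMonoid.normalizedFactors f, P.Monic := fun P hP => by
    rw [← UniqueFactorizationMonoid.normalize_normalized_factor P hP]
    exact monic_normalize (UniqueFactorizationMonoid.irreducible_of_normalized_factor P hP).ne_zero
  have hprod : (UniqueFactorizationMonoid.normalizedFactors f).prod = f := by
    rw [UniqueFactorizationMonoid.prod_normalizedFactors_eq hf.ne_zero, hf.normalize_eq_self]
  have hdeg : f.natDegree =
      ((UniqueFactorizationMonoid.normalizedFactors f).map natDegree).sum := by
    conv_lhs => rw [← hprod]
    exact natDegree_multiset_prod_of_monic _ hmonic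
  rw [hdeg, Finset.sum_multiset_map_count]
  have hsub : (UniqueFactorizationMonoid.normalizedFactors f).toFinset ⊆ monicIrreducibles F N := by
    intro P hP
    rw [Multiset.mem_toFinset] at hP
    exact mem_monicIrreducibles.2 ⟨hmonic P hP, (natDegree_le_of_dvd
      (UniqueFactorizationMonoid.dvd_of_mem_normalizedFactors hP) hf.ne_zero).trans hN,
      UniqueFactorizationMonoid.irreducible_of_normalized_factor P hP⟩
  rw [Finset.sum_subset hsub fun P _ hP => by
    rw [Multiset.mem_toFinset, ← Multiset.count_eq_zero] at hP
    rw [hP, zero_smul]]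
  refine Finset.sum_congr rfl fun P hP => ?_
  obtain ⟨hP, -, hirr⟩ := mem_monicIrreducibles.1 hP
  have hcount : ∀ j, P ^ j ∣ f ↔
      j ≤ (UniqueFactorizationMonoid.normalizedFactors f).count P := fun j => by
    rw [pow_dvd_iff_le_emultiplicity,
      UniqueFactorizationMonoid.emultiplicity_eq_count_normalizedFactors hirr hf.ne_zero,
      hP.normalize_eq_self, Nat.cast_le]
  have hcN : (UniqueFactorizationMonoid.normalizedFactors f).count P ≤ N := by
    have h := natDegree_le_of_dvd ((hcount _).2 le_rfl) hf.ne_zero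
    rw [natDegree_pow] at h
    exact (Nat.le_mul_of_pos_right _ hirr.natDegree_pos).trans (h.trans hN)
  have hfilter : (Icc 1 N).filter (fun j => P ^ j ∣ f) =
      Icc 1 ((UniqueFactorizationMonoid.normalizedFactors f).count P) := by
    ext j
    simp only [mem_filter, mem_Icc, hcount]
    omega
  rw [← Finset.sum_filter, hfilter, Finset.sum_const, Nat.card_Icc, Nat.add_sub_cancel]

variable {R : Type*} [CommRing R] (w : F[X] → R)

/-- The sum of `deg P * w P ^ j` over the monic irreducible polynomials `P` of degree at most `N`
and the exponents `1 ≤ j ≤ N` with `j * deg P = k`. -/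
noncomputable def primePowerSum (N k : ℕ) : R :=
  ∑ P ∈ monicIrreducibles F N, ∑ j ∈ Icc 1 N,
    if j * P.natDegree = k then (P.natDegree : R) * w P ^ j else 0

variable {w} (w_one : w 1 = 1) (w_mul : ∀ f g : F[X], f.Monic → g.Monic → w (f * g) = w f * w g)

omit [Finite F] in
include w_one w_mul in
theorem map_pow_of_monic {P : F[X]} (hP : P.Monic) (j : ℕ) : w (P ^ j) = w P ^ j := by
  induction j with
  | zero => simp [w_one]
  | succ j ih => rw [pow_succ, w_mul _ _ (hP.pow j) hP, ih, pow_succ]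

include w_one w_mul in
theorem sum_monicsOfDegree_pow_dvd {P : F[X]} (hP : P.Monic) (j n : ℕ) :
    (∑ f ∈ monicsOfDegree F n, if P ^ j ∣ f then w f else 0) =
      if j * P.natDegree ≤ n then
        w P ^ j * ∑ g ∈ monicsOfDegree F (n - j * P.natDegree), w g else 0 := by
  split_ifs with h
  · rw [← Finset.sum_filter, Finset.mul_sum]
    symm
    refine Finset.sum_bij (fun g _ => P ^ j * g) (fun g hg => ?_) (fun g _ g' _ hgg => ?_)
      (fun f hf => ?_) (fun g hg => ?_)
    · rw [mem_monicsOfDegree] at hg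
      rw [mem_filter, mem_monicsOfDegree, (hP.pow j).natDegree_mul hg.1, hP.natDegree_pow, hg.2]
      exact ⟨⟨(hP.pow j).mul hg.1, by omega⟩, dvd_mul_right _ _⟩
    · exact mul_left_cancel₀ (hP.pow j).ne_zero hgg
    · rw [mem_filter, mem_monicsOfDegree] at hf
      obtain ⟨⟨hf, hn⟩, g, rfl⟩ := hf
      have hg : g.Monic := (hP.pow j).of_mul_monic_left hf
      rw [(hP.pow j).natDegree_mul hg, hP.natDegree_pow] at hn
      exact ⟨g, mem_monicsOfDegree.2 ⟨hg, by omega⟩, rfl⟩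
    · rw [w_mul _ _ (hP.pow j) (mem_monicsOfDegree.1 hg).1, map_pow_of_monic w_one w_mul hP]
  · refine Finset.sum_eq_zero fun f hf => if_neg fun hd => h ?_
    rw [mem_monicsOfDegree] at hf
    rw [← hP.natDegree_pow, ← hf.2]
    exact natDegree_le_of_dvd hd hf.1.ne_zero

include w_one w_mul in
/-- Newton's identity relating the sums of a multiplicative weight over all monic polynomials
to its sums over prime powers. -/
theorem natCast_mul_sum_monicsOfDegree {n N : ℕ} (hn : n ≤ N) :
    (n : R) * ∑ f ∈ monicsOfDegree F n, w f =
      ∑ k ∈ Icc 1 n, primePowerSum w N k * ∑ f ∈ monicsOfDegree F (n - k), w f := by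
  have hleft : (n : R) * ∑ f ∈ monicsOfDegree F n, w f =
      ∑ P ∈ monicIrreducibles F N, ∑ j ∈ Icc 1 N,
        (P.natDegree : R) * ∑ f ∈ monicsOfDegree F n, if P ^ j ∣ f then w f else 0 := by
    simp_rw [Finset.mul_sum]
    rw [Finset.sum_congr rfl fun P _ => Finset.sum_comm, Finset.sum_comm]
    refine Finset.sum_congr rfl fun f hf => ?_
    rw [mem_monicsOfDegree] at hf
    have h := congrArg (Nat.cast (R := R)) (natDegree_eq_sum_pow_dvd hf.1 (hf.2.trans_le hn))
    rw [hf.2] at h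
    rw [h, Nat.cast_sum, Finset.sum_mul]
    refine Finset.sum_congr rfl fun P _ => ?_
    rw [Nat.cast_sum, Finset.sum_mul]
    refine Finset.sum_congr rfl fun j _ => ?_
    split_ifs <;> simp
  rw [hleft]
  simp_rw [primePowerSum, Finset.sum_mul]
  conv_rhs => rw [Finset.sum_comm]
  refine Finset.sum_congr rfl fun P hP => ?_
  conv_rhs => rw [Finset.sum_comm]
  refine Finset.sum_congr rfl fun j hj => ?_
  obtain ⟨hP, -, hirr⟩ := mem_monicIrreducibles.1 hP
  have hpos : 1 ≤ j * P.natDegree :=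
    Nat.mul_pos (mem_Icc.1 hj).1 hirr.natDegree_pos
  rw [sum_monicsOfDegree_pow_dvd w_one w_mul hP]
  simp_rw [ite_mul, zero_mul]
  rw [Finset.sum_ite_eq]
  simp only [mem_Icc, hpos, true_and]
  split_ifs <;> ring

include w_one w_mul in
theorem primePowerSum_eq_of_sum_eq_zero
    (hw : ∀ n, 2 ≤ n → ∑ f ∈ monicsOfDegree F n, w f = 0) {n N : ℕ} (hn : n + 1 ≤ N) :
    primePowerSum w N (n + 1) = (-1) ^ n * (∑ f ∈ monicsOfDegree F 1, w f) ^ (n + 1) := by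
  have hzero : ∑ f ∈ monicsOfDegree F 0, w f = 1 := by
    have : monicsOfDegree F 0 = {1} := by
      ext f
      rw [mem_monicsOfDegree, mem_singleton]
      exact ⟨fun h => h.1.natDegree_eq_zero.1 h.2, by rintro rfl; simp [monic_one]⟩
    rw [this, Finset.sum_singleton, w_one]
  induction n with
  | zero =>
    have h := natCast_mul_sum_monicsOfDegree w_one w_mul hn
    simpa [hzero] using h.symm
  | succ n ih =>
    have h := natCast_mul_sum_monicsOfDegree w_one w_mul hn
    rw [hw _ (by omega), mul_zero, Finset.sum_Icc_succ_top (by omega),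
      Finset.sum_Icc_succ_top (by omega), Finset.sum_eq_zero fun k hk => by
        rw [mem_Icc] at hk
        rw [hw _ (by omega), mul_zero]] at h
    rw [show n + 1 + 1 - (n + 1) = 1 by omega, Nat.sub_self, hzero, ih (by omega)] at h
    linear_combination -h

end MonicSums

section CharacterWeight

variable {F : Type*} [Field F] {R : Type*} [CommRing R]

/-- The weight of a monic polynomial with roots `αᵢ`: the product of the `χ αᵢ * ψ αᵢ`, computed
as `χ` of the product of the roots times `ψ` of their sum. -/
noncomputable def charWeight (χ : MulChar F R) (ψ : AddChar F R) (f : F[X]) : R :=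
  χ ((-1) ^ f.natDegree * f.coeff 0) * ψ (-f.nextCoeff)

variable (χ : MulChar F R) (ψ : AddChar F R)

theorem charWeight_one : charWeight χ ψ 1 = 1 := by
  simp [charWeight, nextCoeff]

theorem charWeight_mul (f g : F[X]) (hf : f.Monic) (hg : g.Monic) :
    charWeight χ ψ (f * g) = charWeight χ ψ f * charWeight χ ψ g := by
  simp only [charWeight]
  rw [hf.natDegree_mul hg, hf.nextCoeff_mul hg, mul_coeff_zero, neg_add, AddChar.map_add_eq_mul,
    show (-1 : F) ^ (f.natDegree + g.natDegree) * (f.coeff 0 * g.coeff 0) =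
      ((-1) ^ f.natDegree * f.coeff 0) * ((-1) ^ g.natDegree * g.coeff 0) by ring, map_mul]
  ring

theorem sum_monicsOfDegree_one_charWeight [Fintype F] :
    ∑ f ∈ monicsOfDegree F 1, charWeight χ ψ f = gaussSum χ ψ := by
  rw [gaussSum]
  symm
  refine Finset.sum_bij (fun a _ => X - C a) (fun a _ => ?_) (fun a _ b _ hab => ?_)
    (fun f hf => ?_) (fun a _ => ?_)
  · simp [monic_X_sub_C]
  · simpa using hab
  · rw [mem_monicsOfDegree] at hf
    refine ⟨-f.coeff 0, mem_univ _, ?_⟩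
    rw [C_neg, sub_neg_eq_add]
    exact (hf.1.eq_X_add_C hf.2).symm
  · simp [charWeight]

theorem sum_monicsOfDegree_charWeight_eq_zero [Finite F] [IsDomain R] (hχ : χ ≠ 1) {n : ℕ}
    (hn : 2 ≤ n) : ∑ f ∈ monicsOfDegree F n, charWeight χ ψ f = 0 := by
  obtain ⟨u, hu⟩ := MulChar.ne_one_iff.1 hχ
  have hcoeff (a : F) (f : F[X]) : (f + C ((a - 1) * f.coeff 0)).coeff 0 = a * f.coeff 0 := by
    rw [coeff_add, coeff_C_zero]
    ring
  have hmem (a : F) {f : F[X]} (hf : f ∈ monicsOfDegree F n) :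
      f + C ((a - 1) * f.coeff 0) ∈ monicsOfDegree F n := by
    rw [mem_monicsOfDegree] at hf ⊢
    refine ⟨hf.1.add_of_left (degree_C_le.trans_lt ?_), by rw [natDegree_add_C, hf.2]⟩
    rw [← natDegree_pos_iff_degree_pos, hf.2]
    omega
  have hinv (a b : F) (hab : a * b = 1) (f : F[X]) :
      f + C ((a - 1) * f.coeff 0) +
        C ((b - 1) * (f + C ((a - 1) * f.coeff 0)).coeff 0) = f := by
    rw [hcoeff, add_assoc, ← C_add, show (a - 1) * f.coeff 0 + (b - 1) * (a * f.coeff 0) = 0 by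
      linear_combination f.coeff 0 * hab, C_0, add_zero]
  have hsum : ∑ f ∈ monicsOfDegree F n, χ u * charWeight χ ψ f =
      ∑ f ∈ monicsOfDegree F n, charWeight χ ψ f := by
    refine Finset.sum_bij' (fun f _ => f + C (((u : F) - 1) * f.coeff 0))
      (fun f _ => f + C (((u⁻¹ : Fˣ) - 1 : F) * f.coeff 0)) (fun f hf => hmem _ hf)
      (fun f hf => hmem _ hf) (fun f _ => hinv _ _ u.mul_inv f) (fun f _ => hinv _ _ u.inv_mul f)
      (fun f hf => ?_)
    have hd := (mem_monicsOfDegree.1 hf).2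
    have hd' := (mem_monicsOfDegree.1 (hmem u hf)).2
    have hnext : (f + C (((u : F) - 1) * f.coeff 0)).nextCoeff = f.nextCoeff := by
      rw [nextCoeff_of_natDegree_pos (by omega), nextCoeff_of_natDegree_pos (by omega), hd, hd',
        coeff_add, coeff_C_of_ne_zero (by omega), add_zero]
    rw [charWeight, charWeight, hnext, hcoeff, hd, hd', ← mul_assoc, ← map_mul,
      mul_left_comm]
  rw [← Finset.mul_sum] at hsum
  exact (mul_left_eq_self₀.1 hsum).resolve_left hu

theorem charWeight_minpoly_pow [Finite F] {E : Type*} [Field E] [Algebra F E]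
    [FiniteDimensional F E] (α : E) :
    charWeight χ ψ (minpoly F α) ^ (Module.finrank F E / (minpoly F α).natDegree) =
      χ (Algebra.norm F α) * ψ (Algebra.trace F E α) := by
  have hint : IsIntegral F α := .of_finite F α
  have hdeg := IntermediateField.adjoin.finrank hint
  have hfin : Module.finrank F E / (minpoly F α).natDegree =
      Module.finrank (IntermediateField.adjoin F {α}) E := by
    rw [← hdeg, ← Module.finrank_mul_finrank F (IntermediateField.adjoin F {α}) E,
      Nat.mul_div_cancel_left _ Module.finrank_pos]
  have hnorm := Algebra.PowerBasis.norm_gen_eq_coeff_zero_minpoly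
    (IntermediateField.adjoin.powerBasis hint)
  rw [IntermediateField.adjoin.powerBasis_gen, IntermediateField.adjoin.powerBasis_dim,
    IntermediateField.minpoly_gen] at hnorm
  rw [hfin, charWeight, ← hnorm, mul_pow, ← map_pow, ← Algebra.norm_eq_norm_adjoin,
    ← AddChar.map_nsmul_eq_pow, trace_eq_finrank_mul_minpoly_nextCoeff, nsmul_eq_mul]

end CharacterWeight

section FiniteExtension

variable {F E : Type*} [Field F] [Fintype F] [Field E] [Fintype E] [Algebra F E]

theorem card_filter_minpoly_eq {P : F[X]} (hP : P.Monic) (hirr : Irreducible P)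
    (hdvd : P.natDegree ∣ Module.finrank F E) :
    #{α : E | minpoly F α = P} = P.natDegree := by
  have hsplit : (P.map (algebraMap F E)).Splits := by
    have h := hirr.natDegree_dvd_iff_dvd_X_pow_card_pow_sub_X.1 hdvd
    rw [← Module.natCard_eq_pow_finrank] at h
    have hs := splits_X_pow_nat_card_sub_X (K := E)
    refine hs.of_dvd (FiniteField.X_pow_card_sub_X_ne_zero E Finite.one_lt_card) ?_
    simpa using map_dvd (algebraMap F E) h
  rw [← card_rootSet_eq_natDegree (PerfectField.separable_of_irreducible hirr) hsplit,
    ← Set.toFinset_card]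
  congr 1
  ext α
  rw [mem_filter, Set.mem_toFinset, mem_rootSet]
  refine ⟨?_, fun h => ⟨mem_univ _, (minpoly.eq_of_irreducible_of_monic hirr h.2 hP).symm⟩⟩
  rintro ⟨-, rfl⟩
  exact ⟨hP.ne_zero, minpoly.aeval F α⟩

theorem sum_minpoly_pow_eq_primePowerSum {R : Type*} [CommRing R] (w : F[X] → R) :
    ∑ α : E, w (minpoly F α) ^ (Module.finrank F E / (minpoly F α).natDegree) =
      primePowerSum w (Module.finrank F E) (Module.finrank F E) := by
  have hmem (α : E) : minpoly F α ∈ monicIrreducibles F (Module.finrank F E) :=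
    mem_monicIrreducibles.2 ⟨minpoly.monic (.of_finite F α), minpoly.natDegree_le α,
      minpoly.irreducible (.of_finite F α)⟩
  rw [← Finset.sum_fiberwise_of_maps_to (fun α _ => hmem α), primePowerSum]
  refine Finset.sum_congr rfl fun P hP => ?_
  obtain ⟨hP, -, hirr⟩ := mem_monicIrreducibles.1 hP
  rw [Finset.sum_congr rfl fun α hα => by rw [(mem_filter.1 hα).2], Finset.sum_const,
    nsmul_eq_mul]
  by_cases hdvd : P.natDegree ∣ Module.finrank F E
  · rw [card_filter_minpoly_eq hP hirr hdvd, Finset.sum_eq_single_of_mem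
      (Module.finrank F E / P.natDegree) _ fun j _ hj => if_neg fun h => hj ?_,
      if_pos (Nat.div_mul_cancel hdvd)]
    · rw [mem_Icc]
      exact ⟨Nat.div_pos (Nat.le_of_dvd Module.finrank_pos hdvd) hirr.natDegree_pos,
        Nat.div_le_self _ _⟩
    · rw [← h, Nat.mul_div_cancel _ hirr.natDegree_pos]
  · rw [Finset.sum_eq_zero fun j _ => if_neg fun h => hdvd ⟨j, by rw [← h, mul_comm]⟩,
      Finset.filter_eq_empty_iff.2 fun α _ (h : minpoly F α = P) =>
        hdvd (h ▸ minpoly.degree_dvd (.of_finite F α)), Finset.card_empty, Nat.cast_zero, zero_mul]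

/-- The Davenport–Hasse lifting relation for arbitrary characters of a finite field. -/
theorem gaussSum_lift {R : Type*} [CommRing R] [IsDomain R] {χ : MulChar F R} (hχ : χ ≠ 1)
    (ψ : AddChar F R) {χE : MulChar E R} {ψE : AddChar E R}
    (hχE : ∀ α, χE α = χ (Algebra.norm F α)) (hψE : ∀ α, ψE α = ψ (Algebra.trace F E α)) :
    gaussSum χE ψE =
      (-1) ^ (Module.finrank F E - 1) * gaussSum χ ψ ^ Module.finrank F E := by
  have hpos : 0 < Module.finrank F E := Module.finrank_pos
  have h := primePowerSum_eq_of_sum_eq_zero (charWeight_one χ ψ) (charWeight_mul χ ψ)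
    (fun n => sum_monicsOfDegree_charWeight_eq_zero χ ψ hχ)
    (n := Module.finrank F E - 1) (N := Module.finrank F E) (by omega)
  rw [Nat.sub_add_cancel hpos, ← sum_minpoly_pow_eq_primePowerSum (E := E),
    sum_monicsOfDegree_one_charWeight] at h
  rw [← h, gaussSum]
  exact Finset.sum_congr rfl fun α _ => by rw [charWeight_minpoly_pow, hχE, hψE]

end FiniteExtension

/-- **Theorem 2.5 (Davenport–Hasse lifting formula).** If `χ` is the lift to `F_{p^{fs}}`
(via the norm) of a nontrivial multiplicative character `χ'` of `F_{p^f}`, `s ≥ 2`, then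
`G_{p^{fs}}(χ) = (-1)^{s-1} (G_{p^f}(χ'))^s`. -/
theorem davenport_hasse_lifting
    (p f s : ℕ) (hp : p.Prime) (hf : 0 < f) (hs : 2 ≤ s)
    (F E : Type) [Field F] [Fintype F] [Field E] [Fintype E] [Algebra F E]
    [Algebra (ZMod p) F] [Algebra (ZMod p) E]
    (hF : Fintype.card F = p ^ f) (hE : Fintype.card E = p ^ (f * s))
    (χ' : MulChar F ℂ) (hχ' : χ' ≠ 1)
    (χ : MulChar E ℂ) (hlift : ∀ α : E, χ α = χ' (Algebra.norm F α))
    (ψF : AddChar F ℂ) (hψF : ∀ x : F, ψF x = Complex.exp (2 * Real.pi * Complex.I *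
      ((Algebra.trace (ZMod p) F x).val : ℂ) / p))
    (ψE : AddChar E ℂ) (hψE : ∀ x : E, ψE x = Complex.exp (2 * Real.pi * Complex.I *
      ((Algebra.trace (ZMod p) E x).val : ℂ) / p)) :
    gaussSum χ ψE = (-1 : ℂ) ^ (s - 1) * gaussSum χ' ψF ^ s := by
  have : Fact p.Prime := ⟨hp⟩
  have : IsScalarTower (ZMod p) F E := .of_algebraMap_eq' (Subsingleton.elim _ _)
  have hfinrank : Module.finrank F E = s := by
    have hcard := Module.card_eq_pow_finrank (K := F) (V := E)
    rw [hE, hF, ← pow_mul] at hcard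
    exact (Nat.eq_of_mul_eq_mul_left hf (Nat.pow_right_injective hp.two_le hcard)).symm
  rw [gaussSum_lift hχ' ψF hlift fun α => by rw [hψE, hψF, Algebra.trace_trace], hfinrank]
end
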